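/- arXiv:2010.07423 — 4 statements merged into one kernel-verified Lean document; each statement's English description precedes it below -/
import Mathlib

section
/- Let S be a nonempty finite set and let P be a probability distribution on S^4 satisfying the constraints C_L and C_M. Then for every pair of integers N, M ≥ 2 there exists a probability distribution Q on configurations ω : {1,…,N}×{1,…,M} → S that is consistent with P, i.e. for all 1 ≤ i ≤ N−1 and 1 ≤ j ≤ M−1 the pushforward of Q under ω ↦ (ω(i,j), ω(i+1,j), ω(i,j+1), ω(i+1,j+1)) equals P. -/
open Finset

/-- A probability distribution on a finite type: nonnegative and sums to 1. -/
def IsProbDist {α : Type*} [Fintype α] (Q : α → ℝ) : Prop :=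
  (∀ x, 0 ≤ Q x) ∧ ∑ x, Q x = 1

/-- Shannon entropy of a finitely supported distribution. -/
noncomputable def entropy {α : Type*} [Fintype α] (Q : α → ℝ) : ℝ :=
  -∑ x, Q x * Real.log (Q x)

section Marginals

variable {S : Type*} [Fintype S]

/-- Marginal on the bottom pair (a, b). -/
def margAB (P : S × S × S × S → ℝ) : S × S → ℝ :=
  fun p => ∑ z : S, ∑ w : S, P (p.1, p.2, z, w)

/-- Marginal on the top pair (c, d). -/
def margCD (P : S × S × S × S → ℝ) : S × S → ℝ :=
  fun p => ∑ x : S, ∑ y : S, P (x, y, p.1, p.2)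

/-- Marginal on the left vertical pair (a, c). -/
def margAC (P : S × S × S × S → ℝ) : S × S → ℝ :=
  fun p => ∑ y : S, ∑ w : S, P (p.1, y, p.2, w)

/-- Marginal on the right vertical pair (b, d). -/
def margBD (P : S × S × S × S → ℝ) : S × S → ℝ :=
  fun p => ∑ x : S, ∑ z : S, P (x, p.1, z, p.2)

/-- Marginal on the single site a. -/
def margA (P : S × S × S × S → ℝ) : S → ℝ :=
  fun a => ∑ y : S, ∑ z : S, ∑ w : S, P (a, y, z, w)

/-- Marginal on the single site b. -/
def margB (P : S × S × S × S → ℝ) : S → ℝ :=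
  fun b => ∑ x : S, ∑ z : S, ∑ w : S, P (x, b, z, w)

/-- Marginal on the single site c. -/
def margC (P : S × S × S × S → ℝ) : S → ℝ :=
  fun c => ∑ x : S, ∑ y : S, ∑ w : S, P (x, y, c, w)

/-- Marginal on the single site d. -/
def margD (P : S × S × S × S → ℝ) : S → ℝ :=
  fun d => ∑ x : S, ∑ y : S, ∑ z : S, P (x, y, z, d)

/-- Marginal on the triple (a, b, d). -/
def margABD (P : S × S × S × S → ℝ) : S × S × S → ℝ :=
  fun p => ∑ z : S, P (p.1, p.2.1, z, p.2.2)

/-- Marginal on the triple (a, c, d). -/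
def margACD (P : S × S × S × S → ℝ) : S × S × S → ℝ :=
  fun p => ∑ y : S, P (p.1, y, p.2.1, p.2.2)

/-- The linear (translation-invariance) constraints `C_L`. -/
def CL (P : S × S × S × S → ℝ) : Prop :=
  margAB P = margCD P ∧ margAC P = margBD P

/-- The Markovian constraints `C_M`. -/
def CM (P : S × S × S × S → ℝ) : Prop :=
  entropy (margAC P) + entropy (margAB P) - entropy (margA P) - entropy (margABD P) = 0 ∧
  entropy (margAC P) + entropy (margAB P) - entropy (margA P) - entropy (margACD P) = 0

end Marginals

section Grid

variable {S : Type*} [Fintype S] [DecidableEq S]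

/-- The 2×2 cluster of a configuration whose bottom-left corner is at
(0-indexed) position `(i, j)`: (bottom-left, bottom-right, top-left, top-right). -/
def cluster {N M : ℕ} (ω : Fin N × Fin M → S) (i : Fin (N - 1)) (j : Fin (M - 1)) :
    S × S × S × S :=
  (ω (⟨i.1, by have := i.isLt; omega⟩, ⟨j.1, by have := j.isLt; omega⟩),
   ω (⟨i.1 + 1, by have := i.isLt; omega⟩, ⟨j.1, by have := j.isLt; omega⟩),
   ω (⟨i.1, by have := i.isLt; omega⟩, ⟨j.1 + 1, by have := j.isLt; omega⟩),
   ω (⟨i.1 + 1, by have := i.isLt; omega⟩, ⟨j.1 + 1, by have := j.isLt; omega⟩))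

/-- The pushforward (marginal) of a distribution on configurations under the map
sending a configuration to its 2×2 cluster at position `(i, j)`. -/
def marginalAt {N M : ℕ} (Q : (Fin N × Fin M → S) → ℝ)
    (i : Fin (N - 1)) (j : Fin (M - 1)) : S × S × S × S → ℝ :=
  fun p => ∑ ω : Fin N × Fin M → S, if cluster ω i j = p then Q ω else 0

/-- A distribution `Q` on `N × M` configurations is consistent with `P` if every 2×2
cluster marginal of `Q` equals `P`. -/
def Consistent {N M : ℕ} (Q : (Fin N × Fin M → S) → ℝ) (P : S × S × S × S → ℝ) : Prop :=
  ∀ (i : Fin (N - 1)) (j : Fin (M - 1)), marginalAt Q i j = P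

end Grid

section Entropy

variable {X Y Z : Type*} [Fintype X] [Fintype Y] [Fintype Z]

/-- The Gibbs inequality for a single atom, together with its equality case. -/
theorem gibbs_term {j q : ℝ} (hj : 0 ≤ j) (hq : 0 ≤ q) (hjq : q = 0 → j = 0) :
    0 ≤ j * Real.log j - j * Real.log q - j + q ∧
      (j * Real.log j - j * Real.log q - j + q = 0 → j = q) := by
  rcases hq.eq_or_lt with h | hq
  · have hj0 := hjq h.symm
    subst h hj0
    simp
  have key : j * Real.log j - j * Real.log q - j + q = q * InformationTheory.klFun (j / q) := by
    rcases hj.eq_or_lt with h | hj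
    · subst h
      simp [InformationTheory.klFun]
    · rw [InformationTheory.klFun, Real.log_div hj.ne' hq.ne']
      field_simp
      ring
  rw [key]
  refine ⟨mul_nonneg hq.le (InformationTheory.klFun_nonneg (div_nonneg hj hq.le)), fun h => ?_⟩
  have := (mul_eq_zero.1 h).resolve_left hq.ne'
  rw [InformationTheory.klFun_eq_zero_iff (div_nonneg hj hq.le), div_eq_one_iff_eq hq.ne'] at this
  exact this

/-- Vanishing conditional mutual information forces conditional independence. -/
theorem mul_eq_mul_of_entropy_eq {j : X × Y × Z → ℝ} {f : X × Y → ℝ} {g : Y × Z → ℝ} {h : Y → ℝ}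
    (hj : ∀ v, 0 ≤ j v) (hf : ∀ x y, f (x, y) = ∑ z, j (x, y, z))
    (hg : ∀ y z, g (y, z) = ∑ x, j (x, y, z)) (hh : ∀ y, h y = ∑ x, ∑ z, j (x, y, z))
    (hent : entropy f + entropy g - entropy h - entropy j = 0) (x : X) (y : Y) (z : Z) :
    j (x, y, z) * h y = f (x, y) * g (y, z) := by
  have hhf : ∀ y, h y = ∑ x, f (x, y) := fun y => by simp only [hh, hf]
  have hhg : ∀ y, h y = ∑ z, g (y, z) := fun y => by
    simp only [hh, hg]; exact Finset.sum_comm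
  have f0 : ∀ x y, 0 ≤ f (x, y) := fun x y => by rw [hf]; exact sum_nonneg fun _ _ => hj _
  have g0 : ∀ y z, 0 ≤ g (y, z) := fun y z => by rw [hg]; exact sum_nonneg fun _ _ => hj _
  have h0 : ∀ y, 0 ≤ h y := fun y => by rw [hhf]; exact sum_nonneg fun _ _ => f0 _ _
  have jf : ∀ x y z, j (x, y, z) ≤ f (x, y) := fun x y z => by
    rw [hf]; exact single_le_sum (f := fun z => j (x, y, z)) (fun _ _ => hj _) (mem_univ z)
  have jg : ∀ x y z, j (x, y, z) ≤ g (y, z) := fun x y z => by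
    rw [hg]; exact single_le_sum (f := fun x => j (x, y, z)) (fun _ _ => hj _) (mem_univ x)
  have fh : ∀ x y, f (x, y) ≤ h y := fun x y => by
    rw [hhf]; exact single_le_sum (f := fun x => f (x, y)) (fun _ _ => f0 _ _) (mem_univ x)
  set q : X → Y → Z → ℝ := fun x y z => f (x, y) * g (y, z) / h y with hq
  have q0 : ∀ x y z, 0 ≤ q x y z := fun x y z => div_nonneg (mul_nonneg (f0 _ _) (g0 _ _)) (h0 _)
  have hjq : ∀ x y z, q x y z = 0 → j (x, y, z) = 0 := by
    intro x y z hz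
    by_contra hne
    have hpos := (hj (x, y, z)).lt_of_ne' hne
    have := jf x y z
    have := jg x y z
    have := fh x y
    have : 0 < q x y z := div_pos (mul_pos (by linarith) (by linarith)) (by linarith)
    exact this.ne' hz
  set t : X → Y → Z → ℝ := fun x y z => j (x, y, z) * Real.log (j (x, y, z))
    - j (x, y, z) * Real.log (q x y z) - j (x, y, z) + q x y z with ht
  have t_eq : ∀ x y z, t x y z = j (x, y, z) * Real.log (j (x, y, z))
      - j (x, y, z) * Real.log (f (x, y)) - j (x, y, z) * Real.log (g (y, z))
      + j (x, y, z) * Real.log (h y) - j (x, y, z) + q x y z := by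
    intro x y z
    rcases (hj (x, y, z)).eq_or_lt with h0 | hpos
    · simp [ht, ← h0]
    · have := jf x y z
      have := jg x y z
      have := fh x y
      have hf' : f (x, y) ≠ 0 := by linarith
      have hg' : g (y, z) ≠ 0 := by linarith
      have hh' : h y ≠ 0 := by linarith
      simp only [ht, hq]
      rw [Real.log_div (mul_ne_zero hf' hg') hh', Real.log_mul hf' hg']
      ring
  have qsum : ∑ x, ∑ y, ∑ z, q x y z = ∑ y, h y := by
    rw [Finset.sum_comm]
    refine sum_congr rfl fun y _ => ?_
    simp only [hq, ← Finset.sum_div, ← Finset.mul_sum, ← Finset.sum_mul, ← hhf, ← hhg]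
    exact mul_self_div_self _
  have jsum : ∑ x, ∑ y, ∑ z, j (x, y, z) = ∑ y, h y := by
    rw [Finset.sum_comm]
    simp only [hh]
  have ent_j : entropy j = -∑ x, ∑ y, ∑ z, j (x, y, z) * Real.log (j (x, y, z)) := by
    simp only [entropy, Fintype.sum_prod_type]
  have ent_f : entropy f = -∑ x, ∑ y, ∑ z, j (x, y, z) * Real.log (f (x, y)) := by
    simp only [entropy, Fintype.sum_prod_type, ← Finset.sum_mul, ← hf]
  have ent_g : entropy g = -∑ x, ∑ y, ∑ z, j (x, y, z) * Real.log (g (y, z)) := by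
    rw [Finset.sum_comm]
    simp only [entropy, Fintype.sum_prod_type]
    congr 1
    refine sum_congr rfl fun y _ => ?_
    rw [Finset.sum_comm]
    simp only [← Finset.sum_mul, ← hg]
  have ent_h : entropy h = -∑ x, ∑ y, ∑ z, j (x, y, z) * Real.log (h y) := by
    rw [Finset.sum_comm]
    simp only [entropy, ← Finset.sum_mul, ← hh]
  have tsum : ∑ x, ∑ y, ∑ z, t x y z = 0 := by
    simp only [t_eq, Finset.sum_add_distrib, Finset.sum_sub_distrib, qsum, jsum]
    linarith
  have t0 : ∀ x y z, 0 ≤ t x y z := fun x y z => (gibbs_term (hj _) (q0 x y z) (hjq x y z)).1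
  have tz : t x y z = 0 := by
    have h1 := (sum_eq_zero_iff_of_nonneg fun x _ => sum_nonneg fun y _ =>
      sum_nonneg fun z _ => t0 x y z).1 tsum x (mem_univ x)
    have h2 := (sum_eq_zero_iff_of_nonneg fun y _ => sum_nonneg fun z _ => t0 x y z).1 h1 y
      (mem_univ y)
    exact (sum_eq_zero_iff_of_nonneg fun z _ => t0 x y z).1 h2 z (mem_univ z)
  have hjeq := (gibbs_term (hj _) (q0 x y z) (hjq x y z)).2 tz
  rcases (h0 y).eq_or_lt with hy | hy
  · have : f (x, y) = 0 := le_antisymm (hy ▸ fh x y) (f0 x y)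
    rw [← hy, this]
    simp
  · rw [hjeq]
    exact div_mul_cancel₀ _ hy.ne'

end Entropy

namespace PMF

variable {α β γ : Type*}

/-- The joint law of a random variable with law `q` and a second one drawn from the kernel `k`. -/
noncomputable def joint (q : PMF α) (k : α → PMF β) : PMF (α × β) :=
  q.bind fun a => (k a).map (Prod.mk a)

theorem bind_congr_support {q : PMF α} {f g : α → PMF β} (h : ∀ a ∈ q.support, f a = g a) :
    q.bind f = q.bind g := by
  ext b
  simp only [bind_apply]
  refine tsum_congr fun a => ?_
  by_cases ha : q a = 0
  · simp [ha]
  · rw [h a ((mem_support_iff _ _).2 ha)]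

theorem joint_apply (q : PMF α) (k : α → PMF β) (a : α) (b : β) :
    joint q k (a, b) = q a * k a b := by
  classical
  rw [joint, bind_apply, tsum_eq_single a]
  · congr 1
    rw [map_apply, tsum_eq_single b]
    · simp
    · intro b' hb
      simp [hb.symm]
  · intro a' ha
    have : (a, b) ∉ ((k a').map (Prod.mk a')).support := by
      simp [ha]
    rw [(apply_eq_zero_iff _ _).2 this, mul_zero]

theorem map_fun_const (p : PMF α) (b : β) : (p.map fun _ => b) = pure b :=
  map_const p b

theorem map_joint (q : PMF α) (k : α → PMF β) (f : α × β → γ) :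
    (joint q k).map f = q.bind fun a => (k a).map fun b => f (a, b) := by
  simp only [joint, map_bind, map_comp]
  rfl

theorem map_fst_joint (q : PMF α) (k : α → PMF β) : (joint q k).map Prod.fst = q := by
  rw [map_joint]
  simp only [map_fun_const, bind_pure]

theorem map_snd_joint (q : PMF α) (k : α → PMF β) : (joint q k).map Prod.snd = q.bind k := by
  rw [map_joint]
  exact congrArg q.bind (funext fun a => map_id _)

theorem joint_inj {q : PMF α} {k l : α → PMF β} (h : joint q k = joint q l) :
    ∀ a ∈ q.support, k a = l a := by
  intro a ha
  ext b
  have := congrArg (fun r => r (a, b)) h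
  simp only [joint_apply] at this
  exact (ENNReal.mul_right_inj ((mem_support_iff _ _).1 ha) (q.apply_ne_top a)).1 this

theorem map_fst_apply (R : PMF (α × β)) (a : α) : R.map Prod.fst a = ∑' b, R (a, b) := by
  classical
  rw [map_apply, ENNReal.tsum_prod', tsum_eq_single a]
  · simp
  · intro a' ha
    simp [ha.symm]

/-- Every joint law disintegrates along its first coordinate. -/
theorem exists_joint_eq (R : PMF (α × β)) : ∃ k : α → PMF β, joint (R.map Prod.fst) k = R := by
  classical
  have htop : ∀ a, ∑' b, R (a, b) ≠ ⊤ := fun a => by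
    rw [← map_fst_apply]; exact apply_ne_top _ _
  refine ⟨fun a => if h : ∑' b, R (a, b) = 0 then R.map Prod.snd
    else normalize (fun b => R (a, b)) h (htop a), ?_⟩
  ext ⟨a, b⟩
  rw [joint_apply, map_fst_apply]
  split_ifs with h
  · rw [h, zero_mul, ENNReal.tsum_eq_zero.1 h b]
  · rw [normalize_apply, mul_comm, mul_assoc, ENNReal.inv_mul_cancel h (htop a), mul_one]

/-- Follow `ω` up to time `n` and take the value `t` afterwards. -/
def extendAfter (n : ℕ) (ω : ℕ → α) (t : α) : ℕ → α := fun i => if i ≤ n then ω i else t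

/-- The law of the Markov chain with initial law `q` and kernel `k`, frozen after time `n`. -/
noncomputable def chain (q : PMF α) (k : α → PMF α) : ℕ → PMF (ℕ → α)
  | 0 => q.map fun t _ => t
  | n + 1 => (chain q k n).bind fun ω => (k (ω n)).map (extendAfter n ω)

theorem comp_extendAfter (f : α → β) (n : ℕ) (ω : ℕ → α) (t : α) :
    f ∘ extendAfter n ω t = extendAfter n (f ∘ ω) (f t) := by
  ext i
  simp only [extendAfter, Function.comp]
  split_ifs <;> rfl

theorem chain_map_self {q : PMF α} {k : α → PMF α} (hq : q.bind k = q) (n : ℕ) :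
    (chain q k n).map (fun ω => ω n) = q := by
  induction n with
  | zero => simp only [chain, map_comp]; exact map_id q
  | succ n ih =>
    have : ∀ ω : ℕ → α, (fun ω' : ℕ → α => ω' (n + 1)) ∘ extendAfter n ω = id := fun ω => by
      ext t; simp [extendAfter]
    simp only [chain, map_bind, map_comp, this, map_id]
    conv_rhs => rw [← hq, ← ih, bind_map]
    rfl

theorem chain_map_pair {q : PMF α} {k : α → PMF α} (hq : q.bind k = q) {n i : ℕ} (hi : i < n) :
    (chain q k n).map (fun ω => (ω i, ω (i + 1))) = joint q k := by
  induction n with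
  | zero => omega
  | succ n ih =>
    rcases (Nat.lt_succ_iff.1 hi).eq_or_lt with rfl | hi
    · have : ∀ ω : ℕ → α, (fun ω' : ℕ → α => (ω' i, ω' (i + 1))) ∘ extendAfter i ω
          = Prod.mk (ω i) := fun ω => by
        ext t <;> simp [extendAfter]
      simp only [chain, map_bind, map_comp, this]
      conv_rhs => rw [joint, ← chain_map_self hq i, bind_map]
      rfl
    · have : ∀ ω : ℕ → α, (fun ω' : ℕ → α => (ω' i, ω' (i + 1))) ∘ extendAfter n ω
          = fun _ => (ω i, ω (i + 1)) := fun ω => by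
        ext t <;> simp [extendAfter, hi.le, Nat.succ_le_of_lt hi]
      simp only [chain, map_bind, map_comp, this, map_fun_const]
      exact ih hi

theorem chain_map_mem_support {q : PMF α} {k : α → PMF α} (hq : q.bind k = q) {n : ℕ} {ω : ℕ → α}
    (h : ω ∈ (chain q k n).support) : ω n ∈ q.support := by
  rw [← chain_map_self hq n, mem_support_map_iff]
  exact ⟨ω, h, rfl⟩

/-- If the second coordinate of a chain of pairs is updated autonomously, it is a chain. -/
theorem chain_map_snd {q : PMF (α × β)} {k : α × β → PMF (α × β)} {l : β → PMF β}
    (hq : q.bind k = q) (h : ∀ v ∈ q.support, (k v).map Prod.snd = l v.2) (n : ℕ) :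
    (chain q k n).map (fun ω => Prod.snd ∘ ω) = chain (q.map Prod.snd) l n := by
  induction n with
  | zero => simp only [chain, map_comp]; rfl
  | succ n ih =>
    simp only [chain]
    rw [← ih, bind_map, map_bind]
    refine bind_congr_support fun ω hω => ?_
    simp only [Function.comp_def _ (fun ω : ℕ → α × β => Prod.snd ∘ ω)]
    simp only [Function.comp_apply, ← h _ (chain_map_mem_support hq hω), map_comp]
    congr 1
    ext t : 1
    exact comp_extendAfter _ _ _ _

/-- If `κ` intertwines the pair kernel `k` with `l`, then the first coordinate of the chain of pairs
is a chain with kernel `l`, and the last second coordinate is drawn from `κ` given that chain. -/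
theorem chain_map_fst_last {q : PMF α} {κ : α → PMF β} {k : α × β → PMF (α × β)} {l : α → PMF α}
    (hq : q.bind l = q)
    (h : ∀ a ∈ q.support, ((κ a).bind fun b => k (a, b)) = joint (l a) κ) (n : ℕ) :
    (chain (joint q κ) k n).map (fun ω => (Prod.fst ∘ ω, (ω n).2))
      = joint (chain q l n) fun x => κ (x n) := by
  induction n with
  | zero =>
    simp only [chain]
    rw [map_comp, map_joint, joint, bind_map]
    rfl
  | succ n ih =>
    have step : ∀ ω : ℕ → α × β,
        ((k (ω n)).map (extendAfter n ω)).map (fun ω => (Prod.fst ∘ ω, (ω (n + 1)).2))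
          = (k ((Prod.fst ∘ ω) n, (ω n).2)).map
            fun t => (extendAfter n (Prod.fst ∘ ω) t.1, t.2) := by
      intro ω
      rw [map_comp]
      congr 1
      ext t : 1
      simp only [Function.comp_apply, Prod.mk.injEq]
      exact ⟨comp_extendAfter _ _ _ _, by simp [extendAfter]⟩
    have lhs : (chain (joint q κ) k (n + 1)).map (fun ω => (Prod.fst ∘ ω, (ω (n + 1)).2))
        = ((chain (joint q κ) k n).map (fun ω => (Prod.fst ∘ ω, (ω n).2))).bind
          fun v => (k (v.1 n, v.2)).map fun t => (extendAfter n v.1 t.1, t.2) := by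
      simp only [chain, map_bind, step, bind_map]
      rfl
    rw [lhs, ih]
    simp only [joint, chain, bind_bind, bind_map]
    refine bind_congr_support fun x hx => ?_
    have := congrArg (fun r => PMF.map (fun t : α × β => (extendAfter n x t.1, t.2)) r)
      (h (x n) (chain_map_mem_support hq hx))
    simp only [map_bind, map_joint] at this
    simp only [Function.comp_def]
    rw [this]
    simp [extendAfter]

theorem chain_map_fst {q : PMF α} {κ : α → PMF β} {k : α × β → PMF (α × β)} {l : α → PMF α}
    (hq : q.bind l = q)
    (h : ∀ a ∈ q.support, ((κ a).bind fun b => k (a, b)) = joint (l a) κ) (n : ℕ) :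
    (chain (joint q κ) k n).map (fun ω => Prod.fst ∘ ω) = chain q l n := by
  have := congrArg (map Prod.fst) (chain_map_fst_last hq h n)
  rwa [map_comp, map_fst_joint] at this

/-- If the columns form a chain of pairs both of whose coordinates are chains with the same law,
then the rows can be glued so that consecutive rows have the joint law of the pair chain. -/
theorem exists_rows {q : PMF α} {l κ : α → PMF α} {k : α × α → PMF (α × α)}
    (hl : q.bind l = q) (hκ : q.bind κ = q) (hk : (joint q κ).bind k = joint q κ)
    (hfst : ∀ a ∈ q.support, ((κ a).bind fun b => k (a, b)) = joint (l a) κ)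
    (hsnd : ∀ v ∈ (joint q κ).support, (k v).map Prod.snd = l v.2) (N M : ℕ) :
    ∃ Q : PMF (ℕ → ℕ → α), ∀ i < N, ∀ j < M,
      Q.map (fun ω => ((ω j i, ω (j + 1) i), (ω j (i + 1), ω (j + 1) (i + 1))))
        = joint (joint q κ) k := by
  set C := chain (joint q κ) k N
  set R := C.map fun ω => (Prod.fst ∘ ω, Prod.snd ∘ ω) with hR
  have R_fst : R.map Prod.fst = chain q l N := by
    rw [hR, map_comp]
    exact chain_map_fst hl hfst N
  have R_snd : R.map Prod.snd = chain q l N := by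
    rw [hR, map_comp]
    have := chain_map_snd hk hsnd N
    rwa [map_snd_joint, hκ] at this
  obtain ⟨K, hK⟩ := exists_joint_eq R
  have hstat : (R.map Prod.fst).bind K = R.map Prod.fst := by
    rw [← map_snd_joint, hK, R_fst, R_snd]
  refine ⟨chain (R.map Prod.fst) K M, fun i hi j hj => ?_⟩
  have h1 := congrArg (map fun v : (ℕ → α) × (ℕ → α) =>
    ((v.1 i, v.2 i), (v.1 (i + 1), v.2 (i + 1)))) (chain_map_pair hstat hj)
  rw [hK, map_comp] at h1
  refine h1.trans ?_
  rw [hR, map_comp]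
  exact chain_map_pair hk hi

theorem toReal_map_apply [Fintype α] [DecidableEq β] (p : PMF α) (f : α → β) (b : β) :
    (p.map f b).toReal = ∑ a, if f a = b then (p a).toReal else 0 := by
  classical
  rw [map_apply, tsum_fintype, ENNReal.toReal_sum]
  · refine sum_congr rfl fun a _ => ?_
    by_cases h : f a = b
    · simp [h]
    · simp [h, Ne.symm h]
  · intro a _
    split_ifs
    · exact apply_ne_top _ _
    · exact ENNReal.zero_ne_top

theorem isProbDist_toReal [Fintype α] (p : PMF α) : IsProbDist fun a => (p a).toReal := by
  refine ⟨fun _ => ENNReal.toReal_nonneg, ?_⟩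
  rw [← ENNReal.toReal_sum fun a _ => p.apply_ne_top a, ← tsum_fintype (L := .unconditional α),
    p.tsum_coe, ENNReal.toReal_one]

theorem exists_toReal_eq [Fintype α] {P : α → ℝ} (hP : IsProbDist P) :
    ∃ p : PMF α, ∀ a, (p a).toReal = P a := by
  refine ⟨ofFintype (fun a => ENNReal.ofReal (P a)) ?_, fun a => ?_⟩
  · rw [← ENNReal.ofReal_sum_of_nonneg fun a _ => hP.1 a, hP.2, ENNReal.ofReal_one]
  · rw [ofFintype_apply, ENNReal.toReal_ofReal (hP.1 a)]

/-- Vanishing conditional mutual information gives the Markov factorization through any kernel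
disintegrating the law of the last two variables. -/
theorem apply_eq_mul_of_entropy_eq [Fintype α] [Fintype β] [Fintype γ] {J : PMF (α × β × γ)}
    {q : PMF β} {κ : β → PMF γ} (hκ : joint q κ = J.map Prod.snd)
    (hent : entropy (fun v => (J.map (fun v => (v.1, v.2.1)) v).toReal)
      + entropy (fun v => (J.map Prod.snd v).toReal) - entropy (fun y => (q y).toReal)
      - entropy (fun v => (J v).toReal) = 0) (x : α) (y : β) (z : γ) :
    J (x, y, z) = J.map (fun v => (v.1, v.2.1)) (x, y) * κ y z := by
  classical
  have hq : q = J.map fun v => v.2.1 := by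
    rw [← map_fst_joint q κ, hκ, map_comp]
    rfl
  have hf : ∀ x y, (J.map (fun v => (v.1, v.2.1)) (x, y)).toReal = ∑ z, (J (x, y, z)).toReal := by
    intro x y
    simp only [toReal_map_apply, Fintype.sum_prod_type]
    rw [Fintype.sum_eq_single x fun x hx => by simp [hx]]
    rw [Fintype.sum_eq_single y fun x hx => by simp [hx]]
    simp
  have hg : ∀ y z, (J.map Prod.snd (y, z)).toReal = ∑ x, (J (x, y, z)).toReal := by
    intro y z
    simp only [toReal_map_apply]
    simp [Fintype.sum_prod_type]
  have hh : ∀ y, (q y).toReal = ∑ x, ∑ z, (J (x, y, z)).toReal := by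
    intro y
    rw [hq]
    simp only [toReal_map_apply, Fintype.sum_prod_type]
    refine sum_congr rfl fun x _ => ?_
    rw [Fintype.sum_eq_single y fun x hx => by simp [hx]]
    simp
  have key := mul_eq_mul_of_entropy_eq (fun _ => ENNReal.toReal_nonneg) hf hg hh hent x y z
  rw [← hκ, joint_apply, ENNReal.toReal_mul] at key
  rw [← ENNReal.toReal_eq_toReal_iff' (apply_ne_top _ _)
    (ENNReal.mul_ne_top (apply_ne_top _ _) (apply_ne_top _ _)), ENNReal.toReal_mul]
  by_cases hy : (q y).toReal = 0
  · rw [hh, sum_eq_zero_iff_of_nonneg fun _ _ => sum_nonneg fun _ _ => ENNReal.toReal_nonneg] at hy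
    have hy' := hy x (mem_univ x)
    rw [hf, hy', zero_mul]
    exact (sum_eq_zero_iff_of_nonneg fun _ _ => ENNReal.toReal_nonneg).1 hy' z (mem_univ z)
  · refine mul_right_cancel₀ hy ?_
    rw [key]
    ring

theorem ext_toReal {p q : PMF α} (h : ∀ a, (p a).toReal = (q a).toReal) : p = q :=
  PMF.ext fun a =>
    (ENNReal.toReal_eq_toReal_iff' (apply_ne_top _ _) (apply_ne_top _ _)).1 (h a)

end PMF

section Cluster

variable {S : Type*} [Fintype S] {P : S × S × S × S → ℝ} {p : PMF (S × S × S × S)}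

theorem toReal_map_ab (hp : ∀ v, (p v).toReal = P v) (v : S × S) :
    (p.map (fun v => (v.1, v.2.1)) v).toReal = margAB P v := by
  classical
  obtain ⟨a, b⟩ := v
  simp only [PMF.toReal_map_apply, hp, margAB, Fintype.sum_prod_type]
  rw [Fintype.sum_eq_single a fun x hx => by simp [hx]]
  rw [Fintype.sum_eq_single b fun x hx => by simp [hx]]
  simp

theorem toReal_map_cd (hp : ∀ v, (p v).toReal = P v) (v : S × S) :
    (p.map (fun v => (v.2.2.1, v.2.2.2)) v).toReal = margCD P v := by
  classical
  simp only [PMF.toReal_map_apply, hp]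
  simp [margCD, Fintype.sum_prod_type, Prod.ext_iff, ite_and]

theorem toReal_map_ac (hp : ∀ v, (p v).toReal = P v) (v : S × S) :
    (p.map (fun v => (v.1, v.2.2.1)) v).toReal = margAC P v := by
  classical
  obtain ⟨a, c⟩ := v
  simp only [PMF.toReal_map_apply, hp, margAC, Fintype.sum_prod_type]
  rw [Fintype.sum_eq_single a fun x hx => by simp [hx]]
  refine sum_congr rfl fun b _ => ?_
  rw [Fintype.sum_eq_single c fun x hx => by simp [hx]]
  simp

theorem toReal_map_bd (hp : ∀ v, (p v).toReal = P v) (v : S × S) :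
    (p.map (fun v => (v.2.1, v.2.2.2)) v).toReal = margBD P v := by
  classical
  simp only [PMF.toReal_map_apply, hp]
  simp [margBD, Fintype.sum_prod_type, Prod.ext_iff, ite_and]

theorem toReal_map_a (hp : ∀ v, (p v).toReal = P v) (a : S) :
    (p.map (fun v => v.1) a).toReal = margA P a := by
  classical
  simp only [PMF.toReal_map_apply, hp, margA, Fintype.sum_prod_type]
  rw [Fintype.sum_eq_single a fun x hx => by simp [hx]]
  simp

theorem toReal_map_abd (hp : ∀ v, (p v).toReal = P v) (v : S × S × S) :
    (p.map (fun v => (v.1, v.2.1, v.2.2.2)) v).toReal = margABD P v := by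
  classical
  simp only [PMF.toReal_map_apply, hp]
  simp [margABD, Fintype.sum_prod_type, Prod.ext_iff, ite_and]

theorem toReal_map_acd (hp : ∀ v, (p v).toReal = P v) (v : S × S × S) :
    (p.map (fun v => (v.1, v.2.2.1, v.2.2.2)) v).toReal = margACD P v := by
  classical
  simp only [PMF.toReal_map_apply, hp]
  simp [margACD, Fintype.sum_prod_type, Prod.ext_iff, ite_and]

end Cluster


/-- Theorem 1 of the paper: if `P` is a probability distribution on `S⁴`
satisfying `C_L` and `C_M`, then for all `N, M ≥ 2` there is a probability distribution on
`N × M` configurations whose every 2×2 cluster marginal equals `P`. -/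
theorem exists_global_consistent_distribution
    {S : Type*} [Fintype S] [DecidableEq S] [Nonempty S]
    (P : S × S × S × S → ℝ) (hP : IsProbDist P) (hCL : CL P) (hCM : CM P)
    (N M : ℕ) (hN : 2 ≤ N) (hM : 2 ≤ M) :
    ∃ Q : (Fin N × Fin M → S) → ℝ, IsProbDist Q ∧ Consistent Q P := by
  obtain ⟨p, hp⟩ := PMF.exists_toReal_eq hP
  have ab_cd : p.map (fun v => (v.1, v.2.1)) = p.map fun v => (v.2.2.1, v.2.2.2) :=
    PMF.ext_toReal fun v => by rw [toReal_map_ab hp, toReal_map_cd hp, hCL.1]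
  have ac_bd : p.map (fun v => (v.1, v.2.2.1)) = p.map fun v => (v.2.1, v.2.2.2) :=
    PMF.ext_toReal fun v => by rw [toReal_map_ac hp, toReal_map_bd hp, hCL.2]
  have a_b : p.map (fun v => v.1) = p.map fun v => v.2.1 := by
    simpa only [PMF.map_comp, Function.comp_def] using congrArg (PMF.map Prod.fst) ac_bd
  have a_c : p.map (fun v => v.1) = p.map fun v => v.2.2.1 := by
    simpa only [PMF.map_comp, Function.comp_def] using congrArg (PMF.map Prod.fst) ab_cd
  set q := p.map fun v => v.1 with hq
  obtain ⟨l, hl⟩ := PMF.exists_joint_eq (p.map fun v => (v.1, v.2.1))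
  obtain ⟨κ, hκ⟩ := PMF.exists_joint_eq (p.map fun v => (v.1, v.2.2.1))
  simp only [PMF.map_comp, Function.comp_def] at hl hκ
  rw [← hq] at hl hκ
  obtain ⟨k, hk⟩ := PMF.exists_joint_eq (p.map fun v => ((v.1, v.2.2.1), (v.2.1, v.2.2.2)))
  simp only [PMF.map_comp, Function.comp_def] at hk
  rw [← hκ] at hk
  have q_l : q.bind l = q := by
    rw [← PMF.map_snd_joint, hl, PMF.map_comp, a_b]
    rfl
  have q_κ : q.bind κ = q := by
    rw [← PMF.map_snd_joint, hκ, PMF.map_comp, a_c]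
    rfl
  have q_k : (PMF.joint q κ).bind k = PMF.joint q κ := by
    rw [← PMF.map_snd_joint, hk, PMF.map_comp, hκ, ac_bd]
    rfl
  have abd : ∀ a b d, p.map (fun v => (v.1, v.2.1, v.2.2.2)) (a, b, d)
      = p.map (fun v => (v.1, v.2.1)) (a, b) * κ b d := by
    intro a b d
    have := PMF.apply_eq_mul_of_entropy_eq (q := q) (κ := κ)
      (J := p.map fun v => (v.1, v.2.1, v.2.2.2))
      (by rw [PMF.map_comp, hκ, ac_bd]; rfl)
      (by
        simp only [PMF.map_comp, Function.comp_def, ← ac_bd]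
        simp only [hq, toReal_map_ab hp, toReal_map_ac hp, toReal_map_a hp, toReal_map_abd hp]
        linarith [hCM.1]) a b d
    simpa only [PMF.map_comp, Function.comp_def] using this
  have acd : ∀ a c d, p.map (fun v => (v.1, v.2.2.1, v.2.2.2)) (a, c, d)
      = p.map (fun v => (v.1, v.2.2.1)) (a, c) * l c d := by
    intro a c d
    have := PMF.apply_eq_mul_of_entropy_eq (q := q) (κ := l)
      (J := p.map fun v => (v.1, v.2.2.1, v.2.2.2))
      (by rw [PMF.map_comp, hl, ab_cd]; rfl)
      (by
        simp only [PMF.map_comp, Function.comp_def, ← ab_cd]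
        simp only [hq, toReal_map_ab hp, toReal_map_ac hp, toReal_map_a hp, toReal_map_acd hp]
        linarith [hCM.2]) a c d
    simpa only [PMF.map_comp, Function.comp_def] using this
  have hfst : ∀ a ∈ q.support, ((κ a).bind fun b => k (a, b)) = PMF.joint (l a) κ := by
    apply PMF.joint_inj
    have h1 : PMF.joint q (fun a => (κ a).bind fun b => k (a, b))
        = p.map fun v => (v.1, v.2.1, v.2.2.2) := by
      have := congrArg (PMF.map fun v : (S × S) × S × S => (v.1.1, v.2)) hk
      simp only [PMF.map_comp, Function.comp_def, PMF.map_joint] at this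
      rw [← this]
      simp only [PMF.joint, PMF.map_bind, PMF.bind_bind, PMF.bind_map]
      rfl
    rw [h1]
    ext ⟨a, b, d⟩
    rw [abd, ← hl, PMF.joint_apply, PMF.joint_apply, PMF.joint_apply, mul_assoc]
  have hsnd : ∀ v ∈ (PMF.joint q κ).support, (k v).map Prod.snd = l v.2 := by
    apply PMF.joint_inj
    ext ⟨⟨a, c⟩, d⟩
    rw [PMF.joint_apply _ fun v : S × S => l v.2, hκ, ← acd, ← hκ]
    have h1 : PMF.joint (PMF.joint q κ) (fun v => (k v).map Prod.snd)
        = (p.map fun v => (v.1, v.2.2.1, v.2.2.2)).map fun v => ((v.1, v.2.1), v.2.2) := by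
      have := congrArg (PMF.map fun v : (S × S) × S × S => (v.1, v.2.2)) hk
      simp only [PMF.map_comp, Function.comp_def, PMF.map_joint] at this ⊢
      rw [← this]
      simp only [PMF.joint, PMF.map_comp]
      rfl
    rw [h1, ← ENNReal.toReal_eq_toReal_iff' (PMF.apply_ne_top _ _) (PMF.apply_ne_top _ _),
      PMF.toReal_map_apply]
    simp [Fintype.sum_prod_type, ite_and, Finset.sum_ite_irrel]
  obtain ⟨Q, hQ⟩ := PMF.exists_rows q_l q_κ q_k hfst hsnd N M
  refine ⟨fun ω => (Q.map (fun ω (v : Fin N × Fin M) => ω v.2 v.1) ω).toReal,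
    PMF.isProbDist_toReal _, fun i j => ?_⟩
  ext v
  rw [marginalAt, ← PMF.toReal_map_apply, ← hp, PMF.map_comp]
  have := congrArg (PMF.map fun v : (S × S) × S × S => (v.1.1, v.2.1, v.1.2, v.2.2))
    (hQ i (by omega) j (by omega))
  rw [hk, PMF.map_comp, PMF.map_comp] at this
  exact congrArg (fun r : PMF (S × S × S × S) => (r v).toReal) (this.trans (PMF.map_id p))
end

section
/- Let S be a nonempty finite set and let P be a probability distribution on S^4 satisfying the constraints C_L and C_M, and let N, M ≥ 2 be integers. Then the maximum of the Shannon entropy H(Q), over all probability distributions Q on configurations ω : {1,…,N}×{1,…,M} → S that are consistent with P, exists and equals (N−1)(M−1)·H(P) + (N−2)(M−2)·H(P_a) − (N−2)(M−1)·H(P_{ac}) − (N−1)(M−2)·H(P_{ab}). -/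
open Finset

section Gibbs

variable {α : Type*}

lemma mul_log_sub_mul_log_le {q r : ℝ} (hq : 0 ≤ q) (hr : 0 ≤ r) (hqr : 0 < q → 0 < r) :
    q * Real.log r - q * Real.log q ≤ r - q := by
  rcases hq.eq_or_lt with rfl | hq'
  · simpa using hr
  · have hr' := hqr hq'
    have h := mul_le_mul_of_nonneg_left (Real.log_le_sub_one_of_pos (div_pos hr' hq')) hq
    rw [Real.log_div hr'.ne' hq'.ne', mul_sub, mul_sub, mul_div_cancel₀ _ hq'.ne'] at h
    linarith

lemma eq_of_mul_log_sub_mul_log_eq {q r : ℝ} (hq : 0 ≤ q) (hqr : 0 < q → 0 < r)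
    (h : q * Real.log r - q * Real.log q = r - q) : q = r := by
  rcases hq.eq_or_lt with rfl | hq'
  · simpa using h
  · have hr' := hqr hq'
    by_contra hne
    have h1 : r / q ≠ 1 := fun h1 => hne (by rw [div_eq_one_iff_eq hq'.ne'] at h1; exact h1.symm)
    have h2 := mul_lt_mul_of_pos_left (Real.log_lt_sub_one_of_pos (div_pos hr' hq') h1) hq'
    rw [Real.log_div hr'.ne' hq'.ne', mul_sub, mul_sub, mul_div_cancel₀ _ hq'.ne'] at h2
    linarith

variable [Fintype α] {Q R : α → ℝ}

/-- Gibbs' inequality. -/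
lemma entropy_le_neg_sum_mul_log (hQ : ∀ x, 0 ≤ Q x) (hR : ∀ x, 0 ≤ R x)
    (hQR : ∀ x, 0 < Q x → 0 < R x) (hsum : ∑ x, R x = ∑ x, Q x) :
    entropy Q ≤ -∑ x, Q x * Real.log (R x) := by
  have h := sum_le_sum fun x (_ : x ∈ univ) => mul_log_sub_mul_log_le (hQ x) (hR x) (hQR x)
  rw [sum_sub_distrib, sum_sub_distrib] at h
  unfold entropy
  linarith

/-- The equality case of Gibbs' inequality. -/
lemma eq_of_entropy_eq_neg_sum_mul_log (hQ : ∀ x, 0 ≤ Q x) (hR : ∀ x, 0 ≤ R x)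
    (hQR : ∀ x, 0 < Q x → 0 < R x) (hsum : ∑ x, R x = ∑ x, Q x)
    (h : entropy Q = -∑ x, Q x * Real.log (R x)) : Q = R := by
  have heq := (sum_eq_sum_iff_of_le fun x (_ : x ∈ univ) =>
    mul_log_sub_mul_log_le (hQ x) (hR x) (hQR x)).1 (by
      rw [sum_sub_distrib, sum_sub_distrib]
      unfold entropy at h
      linarith)
  exact funext fun x => eq_of_mul_log_sub_mul_log_eq (hQ x) (hQR x) (heq x (mem_univ x))

end Gibbs

/-- If the conditional mutual information of the outer two coordinates given the middle one
vanishes, then the outer coordinates are conditionally independent given the middle one. -/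
lemma mul_eq_mul_of_entropy_eq_s1 {S : Type*} [Fintype S] {F : S × S × S → ℝ} {G H : S × S → ℝ}
    {K : S → ℝ} (hF : ∀ p, 0 ≤ F p) (hG : ∀ x y, G (x, y) = ∑ z, F (x, y, z))
    (hH : ∀ y z, H (y, z) = ∑ x, F (x, y, z)) (hK : ∀ y, K y = ∑ x, G (x, y))
    (h : entropy G + entropy H - entropy K - entropy F = 0) (x y z : S) :
    F (x, y, z) * K y = G (x, y) * H (y, z) := by
  have hG0 : ∀ x y, 0 ≤ G (x, y) := fun x y => by rw [hG]; exact sum_nonneg fun _ _ => hF _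
  have hH0 : ∀ y z, 0 ≤ H (y, z) := fun x y => by rw [hH]; exact sum_nonneg fun _ _ => hF _
  have hK0 : ∀ y, 0 ≤ K y := fun x => by rw [hK]; exact sum_nonneg fun _ _ => hG0 _ _
  have hK' : ∀ y, K y = ∑ z, H (y, z) := fun y => by
    simp only [hK, hG, hH]; exact sum_comm
  have hFG : ∀ x y z, F (x, y, z) ≤ G (x, y) := fun x y z => by
    rw [hG]; exact single_le_sum (f := fun z => F (x, y, z)) (fun _ _ => hF _) (mem_univ z)
  have hFH : ∀ x y z, F (x, y, z) ≤ H (y, z) := fun x y z => by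
    rw [hH]; exact single_le_sum (f := fun x => F (x, y, z)) (fun _ _ => hF _) (mem_univ x)
  have hGK : ∀ x y, G (x, y) ≤ K y := fun x y => by
    rw [hK]; exact single_le_sum (f := fun x => G (x, y)) (fun _ _ => hG0 _ _) (mem_univ x)
  set R : S × S × S → ℝ := fun p => G (p.1, p.2.1) * H (p.2.1, p.2.2) / K p.2.1 with hR
  have hsum : ∑ p, R p = ∑ p, F p := by
    simp only [hR, Fintype.sum_prod_type]
    simp only [← sum_div, ← mul_sum, ← hK', ← hG]
    refine sum_congr rfl fun x _ => sum_congr rfl fun y _ => ?_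
    rcases eq_or_ne (K y) 0 with h0 | h0
    · have := hGK x y
      have := hG0 x y
      rw [h0]; simp; linarith
    · rw [mul_div_cancel_right₀ _ h0]
  have hlog : ∀ x y z, F (x, y, z) * Real.log (R (x, y, z)) =
      F (x, y, z) * Real.log (G (x, y)) + F (x, y, z) * Real.log (H (y, z))
        - F (x, y, z) * Real.log (K y) := fun x y z => by
    rcases (hF (x, y, z)).eq_or_lt with h0 | h0
    · simp [← h0]
    · have h1 := h0.trans_le (hFG x y z)
      have h2 := h0.trans_le (hFH x y z)
      have h3 := h1.trans_le (hGK x y)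
      simp only [hR]
      rw [Real.log_div (mul_pos h1 h2).ne' h3.ne', Real.log_mul h1.ne' h2.ne']
      ring
  have e1 : ∑ x, ∑ y, ∑ z, F (x, y, z) * Real.log (G (x, y)) = -entropy G := by
    simp only [entropy, neg_neg, Fintype.sum_prod_type, ← sum_mul, ← hG]
  have e2 : ∑ x, ∑ y, ∑ z, F (x, y, z) * Real.log (H (y, z)) = -entropy H := by
    simp only [entropy, neg_neg, Fintype.sum_prod_type, hH, sum_mul]
    rw [sum_comm]
    exact sum_congr rfl fun y _ => sum_comm
  have e3 : ∑ x, ∑ y, ∑ z, F (x, y, z) * Real.log (K y) = -entropy K := by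
    simp only [entropy, neg_neg, ← sum_mul, ← hG]
    rw [sum_comm]
    simp only [← sum_mul, ← hK]
  have hFR : F = R := by
    refine eq_of_entropy_eq_neg_sum_mul_log hF
      (fun p => div_nonneg (mul_nonneg (hG0 _ _) (hH0 _ _)) (hK0 _)) ?_ hsum ?_
    · rintro ⟨x, y, z⟩ h0
      have h1 := h0.trans_le (hFG x y z)
      exact div_pos (mul_pos h1 (h0.trans_le (hFH x y z))) (h1.trans_le (hGK x y))
    · simp only [Fintype.sum_prod_type, hlog, sum_sub_distrib, sum_add_distrib, e1, e2, e3]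
      linarith
  have := congrFun hFR (x, y, z)
  rw [this]
  simp only [hR]
  rcases eq_or_ne (K y) 0 with h0 | h0
  · have := hGK x y
    have := hG0 x y
    have : G (x, y) = 0 := by linarith
    simp [this]
  · field_simp

section Chain

variable {T U : Type*}

/-- The weight of a trajectory of the Markov chain with pair law `R` and one-point law `μ`. -/
noncomputable def chain (R : T → T → ℝ) (μ : T → ℝ) (n : ℕ) (ω : Fin (n + 1) → T) : ℝ :=
  μ (ω 0) * ∏ i : Fin n, R (ω i.castSucc) (ω i.succ) / μ (ω i.castSucc)

/-- `R` is a nonnegative weight on pairs both of whose marginals are `μ`. -/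
structure IsStationaryPair [Fintype T] (R : T → T → ℝ) (μ : T → ℝ) : Prop where
  nonneg : ∀ s t, 0 ≤ R s t
  sum_right : ∀ s, ∑ t, R s t = μ s
  sum_left : ∀ t, ∑ s, R s t = μ t

lemma sum_pi_fin_cons [Fintype T] {n : ℕ} (F : (Fin (n + 1) → T) → ℝ) :
    ∑ ω, F ω = ∑ s, ∑ ω : Fin n → T, F (Fin.cons s ω) := by
  rw [← (Fin.consEquiv fun _ : Fin (n + 1) => T).sum_comp, Fintype.sum_prod_type]
  rfl

lemma sum_pi_fin_snoc [Fintype T] {n : ℕ} (F : (Fin (n + 1) → T) → ℝ) :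
    ∑ ω, F ω = ∑ s, ∑ ω : Fin n → T, F (Fin.snoc ω s) := by
  rw [← (Fin.snocEquiv fun _ : Fin (n + 1) => T).sum_comp, Fintype.sum_prod_type]
  rfl

lemma comp_fin_cons {n : ℕ} (π : T → U) (s : T) (ω : Fin n → T) :
    (fun i => π ((Fin.cons s ω : Fin (n + 1) → T) i)) = Fin.cons (π s) fun i => π (ω i) := by
  funext i
  refine Fin.cases ?_ (fun i => ?_) i <;> simp

lemma comp_fin_snoc {n : ℕ} (π : T → U) (s : T) (ω : Fin n → T) :
    (fun i => π ((Fin.snoc ω s : Fin (n + 1) → T) i)) = Fin.snoc (fun i => π (ω i)) (π s) := by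
  funext i
  refine Fin.lastCases ?_ (fun i => ?_) i <;> simp

lemma chain_snoc (R : T → T → ℝ) (μ : T → ℝ) {n : ℕ} (ω : Fin (n + 1) → T) (t : T) :
    chain R μ (n + 1) (Fin.snoc ω t) =
      chain R μ n ω * (R (ω (Fin.last n)) t / μ (ω (Fin.last n))) := by
  have h0 : (Fin.snoc ω t : Fin (n + 2) → T) 0 = ω 0 := by
    rw [← Fin.castSucc_zero, Fin.snoc_castSucc]
  simp only [chain, Fin.prod_univ_castSucc (n := n), Fin.snoc_castSucc, h0, Fin.succ_last,
    Fin.snoc_last, ← Fin.castSucc_succ, mul_assoc]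

lemma chain_eq_zero_of_first (R : T → T → ℝ) {μ : T → ℝ} {n : ℕ} {ω : Fin (n + 1) → T}
    (h0 : μ (ω 0) = 0) : chain R μ n ω = 0 := by
  simp [chain, h0]

namespace IsStationaryPair

variable [Fintype T] [Fintype U] {R : T → T → ℝ} {μ : T → ℝ} {R' : U → U → ℝ} {μ' : U → ℝ}

lemma marginal_nonneg (h : IsStationaryPair R μ) (s : T) : 0 ≤ μ s := by
  rw [← h.sum_right]; exact sum_nonneg fun _ _ => h.nonneg _ _

lemma le_left (h : IsStationaryPair R μ) (s t : T) : R s t ≤ μ s := by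
  rw [← h.sum_right]
  exact single_le_sum (f := fun t => R s t) (fun _ _ => h.nonneg _ _) (mem_univ t)

lemma le_right (h : IsStationaryPair R μ) (s t : T) : R s t ≤ μ t := by
  rw [← h.sum_left]
  exact single_le_sum (f := fun s => R s t) (fun _ _ => h.nonneg _ _) (mem_univ s)

lemma chain_nonneg (h : IsStationaryPair R μ) (n : ℕ) (ω : Fin (n + 1) → T) :
    0 ≤ chain R μ n ω :=
  mul_nonneg (h.marginal_nonneg _)
    (prod_nonneg fun _ _ => div_nonneg (h.nonneg _ _) (h.marginal_nonneg _))

lemma eq_zero_of_left (h : IsStationaryPair R μ) {s : T} (hs : μ s = 0) (t : T) : R s t = 0 :=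
  le_antisymm (hs ▸ h.le_left s t) (h.nonneg _ _)

lemma eq_zero_of_right (h : IsStationaryPair R μ) {t : T} (ht : μ t = 0) (s : T) : R s t = 0 :=
  le_antisymm (ht ▸ h.le_right s t) (h.nonneg _ _)

lemma chain_cons (h : IsStationaryPair R μ) {n : ℕ} (s : T) (ω : Fin (n + 1) → T) :
    chain R μ (n + 1) (Fin.cons s ω) = chain R μ n ω * (R s (ω 0) / μ (ω 0)) := by
  simp only [chain, Fin.prod_univ_succ (n := n), Fin.cons_zero, Fin.cons_succ, Fin.castSucc_zero,
    ← Fin.succ_castSucc]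
  generalize ∏ i : Fin n, R (ω i.castSucc) (ω i.succ) / μ (ω i.castSucc) = c
  rcases eq_or_ne (μ (ω 0)) 0 with h0 | h0
  · simp [h.eq_zero_of_right h0]
  rcases eq_or_ne (μ s) 0 with hs | hs
  · simp [h.eq_zero_of_left hs]
  field_simp

lemma chain_eq_zero_of_last (h : IsStationaryPair R μ) {n : ℕ} {ω : Fin (n + 1) → T}
    (h0 : μ (ω (Fin.last n)) = 0) : chain R μ n ω = 0 := by
  cases n with
  | zero => exact chain_eq_zero_of_first R h0
  | succ n =>
    simp only [chain, Fin.prod_univ_castSucc (n := n), Fin.succ_last]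
    simp [h.eq_zero_of_right h0]

lemma sum_chain_mul_first (h : IsStationaryPair R μ) (n : ℕ) (g : T → ℝ) :
    ∑ ω, chain R μ n ω * g (ω 0) = ∑ s, μ s * g s := by
  induction n generalizing g with
  | zero =>
    rw [sum_pi_fin_cons]
    simp [chain]
  | succ n ih =>
    rw [sum_pi_fin_cons, sum_comm]
    simp only [h.chain_cons, Fin.cons_zero, mul_assoc, ← mul_sum]
    rw [ih fun t => ∑ s, R s t / μ t * g s]
    simp only [mul_sum]
    rw [sum_comm]
    refine sum_congr rfl fun s _ => ?_
    rw [← h.sum_right, sum_mul]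
    refine sum_congr rfl fun t _ => ?_
    rcases eq_or_ne (μ t) 0 with h0 | h0
    · simp [h0, h.eq_zero_of_right h0]
    · field_simp

/-- Every pair of consecutive states of the chain has law `R`. -/
lemma sum_chain_mul_pair (h : IsStationaryPair R μ) (n : ℕ) (i : Fin n) (f : T → T → ℝ) :
    ∑ ω, chain R μ n ω * f (ω i.castSucc) (ω i.succ) = ∑ s, ∑ t, R s t * f s t := by
  induction n with
  | zero => exact i.elim0
  | succ n ih =>
    rw [sum_pi_fin_cons, sum_comm]
    simp only [h.chain_cons, mul_assoc, ← mul_sum]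
    refine Fin.cases ?_ (fun i => ?_) i
    · simp only [Fin.castSucc_zero, Fin.cons_zero, Fin.cons_succ]
      rw [h.sum_chain_mul_first n fun t => ∑ s, R s t / μ t * f s t, sum_comm]
      refine sum_congr rfl fun t _ => ?_
      rw [mul_sum]
      refine sum_congr rfl fun s _ => ?_
      rcases eq_or_ne (μ t) 0 with h0 | h0
      · simp [h0, h.eq_zero_of_right h0]
      · field_simp
    · simp only [← Fin.succ_castSucc, Fin.cons_succ]
      rw [← ih i]
      refine sum_congr rfl fun ω _ => ?_
      rw [← sum_mul, ← sum_div, h.sum_left]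
      rcases eq_or_ne (μ (ω 0)) 0 with h0 | h0
      · simp [chain_eq_zero_of_first R h0]
      · rw [div_self h0, one_mul]

/-- Lumping of a chain whose forward transition probabilities factor through `π`. -/
lemma sum_chain_mul_comp_of_forward (h : IsStationaryPair R μ) (π : T → U)
    (hμ : ∀ g : U → ℝ, ∑ s, μ s * g (π s) = ∑ u, μ' u * g u)
    (hR : ∀ s, μ s ≠ 0 → ∀ g : U → ℝ,
      ∑ t, R s t / μ s * g (π t) = ∑ u, R' (π s) u / μ' (π s) * g u)
    (n : ℕ) (f : (Fin (n + 1) → U) → ℝ) :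
    ∑ ω, chain R μ n ω * f (fun i => π (ω i)) = ∑ x, chain R' μ' n x * f x := by
  induction n with
  | zero =>
    rw [sum_pi_fin_cons, sum_pi_fin_cons]
    simpa [chain, comp_fin_cons, Subsingleton.elim (fun i => π ((default : Fin 0 → T) i)) default]
      using hμ fun u => f (Fin.cons u default)
  | succ n ih =>
    rw [sum_pi_fin_snoc, sum_pi_fin_snoc, sum_comm, sum_comm (s := (univ : Finset U))]
    simp only [comp_fin_snoc, chain_snoc, mul_assoc, ← mul_sum]
    rw [← ih fun x => ∑ u, R' (x (Fin.last n)) u / μ' (x (Fin.last n)) * f (Fin.snoc x u)]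
    refine sum_congr rfl fun ω _ => ?_
    rcases eq_or_ne (μ (ω (Fin.last n))) 0 with h0 | h0
    · simp [h.chain_eq_zero_of_last h0]
    · rw [hR _ h0 fun u => f (Fin.snoc (fun i => π (ω i)) u)]

/-- Lumping of a chain whose backward transition probabilities factor through `π`. -/
lemma sum_chain_mul_comp_of_backward (h : IsStationaryPair R μ) (h' : IsStationaryPair R' μ')
    (π : T → U)
    (hμ : ∀ g : U → ℝ, ∑ s, μ s * g (π s) = ∑ u, μ' u * g u)
    (hR : ∀ t, μ t ≠ 0 → ∀ g : U → ℝ,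
      ∑ s, R s t / μ t * g (π s) = ∑ u, R' u (π t) / μ' (π t) * g u)
    (n : ℕ) (f : (Fin (n + 1) → U) → ℝ) :
    ∑ ω, chain R μ n ω * f (fun i => π (ω i)) = ∑ x, chain R' μ' n x * f x := by
  induction n with
  | zero =>
    rw [sum_pi_fin_cons, sum_pi_fin_cons]
    simpa [chain, comp_fin_cons, Subsingleton.elim (fun i => π ((default : Fin 0 → T) i)) default]
      using hμ fun u => f (Fin.cons u default)
  | succ n ih =>
    rw [sum_pi_fin_cons, sum_pi_fin_cons, sum_comm, sum_comm (s := (univ : Finset U))]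
    simp only [comp_fin_cons, h.chain_cons, h'.chain_cons, mul_assoc, ← mul_sum]
    rw [← ih fun x => ∑ u, R' u (x 0) / μ' (x 0) * f (Fin.cons u x)]
    refine sum_congr rfl fun ω _ => ?_
    rcases eq_or_ne (μ (ω 0)) 0 with h0 | h0
    · simp [chain_eq_zero_of_first R h0]
    · rw [hR _ h0 fun u => f (Fin.cons u fun i => π (ω i))]

variable {n : ℕ} {ω : Fin (n + 1 + 1) → T}

lemma chain_pos (h : IsStationaryPair R μ)
    (hω : ∀ i : Fin (n + 1), 0 < R (ω i.castSucc) (ω i.succ)) : 0 < chain R μ (n + 1) ω :=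
  have hμ : ∀ i : Fin (n + 1), 0 < μ (ω i.castSucc) := fun i => (hω i).trans_le (h.le_left _ _)
  mul_pos (hμ 0) (prod_pos fun i _ => div_pos (hω i) (hμ i))

lemma log_chain (h : IsStationaryPair R μ)
    (hω : ∀ i : Fin (n + 1), 0 < R (ω i.castSucc) (ω i.succ)) :
    Real.log (chain R μ (n + 1) ω) = Real.log (μ (ω 0)) + ∑ i : Fin (n + 1),
      (Real.log (R (ω i.castSucc) (ω i.succ)) - Real.log (μ (ω i.castSucc))) := by
  have hμ : ∀ i : Fin (n + 1), 0 < μ (ω i.castSucc) := fun i => (hω i).trans_le (h.le_left _ _)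
  have hμ0 : 0 < μ (ω 0) := hμ 0
  rw [chain, Real.log_mul hμ0.ne' (prod_pos fun i _ => div_pos (hω i) (hμ i)).ne',
    Real.log_prod fun i _ => (div_pos (hω i) (hμ i)).ne']
  simp only [Real.log_div (hω _).ne' (hμ _).ne']

end IsStationaryPair

end Chain

section Cluster

variable {S : Type*} [Fintype S] {P : S × S × S × S → ℝ}

lemma margAB_pos (hP : IsProbDist P) {a b c d : S} (h : 0 < P (a, b, c, d)) :
    0 < margAB P (a, b) :=
  sum_pos' (fun _ _ => sum_nonneg fun _ _ => hP.1 _) ⟨c, mem_univ c,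
    sum_pos' (fun _ _ => hP.1 _) ⟨d, mem_univ d, h⟩⟩

lemma sum_mul_margAB (f : S → S → ℝ) :
    ∑ p : S × S × S × S, P p * f p.1 p.2.1 = ∑ p : S × S, margAB P p * f p.1 p.2 := by
  simp only [margAB, Fintype.sum_prod_type, sum_mul]

lemma sum_mul_margAC (f : S → S → ℝ) :
    ∑ p : S × S × S × S, P p * f p.1 p.2.2.1 = ∑ p : S × S, margAC P p * f p.1 p.2 := by
  simp only [margAC, Fintype.sum_prod_type, sum_mul]
  exact sum_congr rfl fun _ _ => sum_comm

lemma sum_mul_margA (f : S → ℝ) :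
    ∑ p : S × S × S × S, P p * f p.1 = ∑ a, margA P a * f a := by
  simp only [margA, Fintype.sum_prod_type, sum_mul]

lemma sum_margAB (a : S) : ∑ b, margAB P (a, b) = margA P a := rfl

lemma sum_margAC (a : S) : ∑ c, margAC P (a, c) = margA P a := by
  simp only [margAC, margA]
  exact sum_comm

namespace CL

lemma sum_margAB_left (h : CL P) (b : S) : ∑ a, margAB P (a, b) = margA P b := by
  have : ∑ a, margAB P (a, b) = ∑ d, margBD P (b, d) := 
    (sum_comm.trans (sum_congr rfl fun _ _ => sum_comm)).symm
  rw [this, ← h.2, sum_margAC]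

lemma sum_margAC_left (h : CL P) (c : S) : ∑ a, margAC P (a, c) = margA P c := by
  have : ∑ a, margAC P (a, c) = ∑ d, margCD P (c, d) := 
    (sum_comm.trans (sum_congr rfl fun _ _ => sum_comm)).symm
  rw [this, ← h.1, sum_margAB]

/-- The horizontal pairs of a cluster. -/
lemma isStationaryPair_row (h : CL P) (hP : ∀ p, 0 ≤ P p) :
    IsStationaryPair (fun a b => margAB P (a, b)) (margA P) where
  nonneg _ _ := sum_nonneg fun _ _ => sum_nonneg fun _ _ => hP _
  sum_right := sum_margAB
  sum_left := h.sum_margAB_left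

/-- A cluster, viewed as a pair of consecutive columns. -/
lemma isStationaryPair_col (h : CL P) (hP : ∀ p, 0 ≤ P p) :
    IsStationaryPair (fun s t : S × S => P (s.1, t.1, s.2, t.2)) (margAC P) where
  nonneg _ _ := hP _
  sum_right _ := Fintype.sum_prod_type _
  sum_left t := by
    rw [h.2]
    exact Fintype.sum_prod_type _

lemma margACD_mul (h : CL P) (hP : ∀ p, 0 ≤ P p) (hM : CM P) (a c d : S) :
    margACD P (a, c, d) * margA P c = margAC P (a, c) * margAB P (c, d) := by
  refine mul_eq_mul_of_entropy_eq_s1 (fun p => sum_nonneg fun _ _ => hP _) ?_ ?_ ?_ hM.2 a c d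
  · intro a c
    exact sum_comm
  · intro c d
    rw [h.1]
    rfl
  · exact fun c => (h.sum_margAC_left c).symm

lemma margABD_mul (h : CL P) (hP : ∀ p, 0 ≤ P p) (hM : CM P) (a b d : S) :
    margABD P (a, b, d) * margA P b = margAB P (a, b) * margAC P (b, d) := by
  have hM' : entropy (margAB P) + entropy (margAC P) - entropy (margA P)
      - entropy (margABD P) = 0 := by linarith [hM.1]
  refine mul_eq_mul_of_entropy_eq_s1 (fun p => sum_nonneg fun _ _ => hP _) ?_ ?_ ?_ hM' a b d
  · intro a b
    exact sum_comm
  · intro b d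
    rw [h.2]
    rfl
  · exact fun b => (h.sum_margAB_left b).symm

end CL

end Cluster

section TwoRows

variable {S : Type*} [Fintype S]

/-- The Markov chain law of a single row. -/
noncomputable def rowLaw (P : S × S × S × S → ℝ) (n : ℕ) : (Fin (n + 1) → S) → ℝ :=
  chain (fun a b => margAB P (a, b)) (margA P) n

/-- The joint law of two consecutive rows: a Markov chain of columns of height two. -/
noncomputable def rowPairLaw (P : S × S × S × S → ℝ) (n : ℕ) (x y : Fin (n + 1) → S) : ℝ :=
  chain (fun s t : S × S => P (s.1, t.1, s.2, t.2)) (margAC P) n fun i => (x i, y i)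

variable {P : S × S × S × S → ℝ} {n : ℕ}

lemma sum_rowPairLaw_mul (f : (Fin (n + 1) → S) → (Fin (n + 1) → S) → ℝ) :
    ∑ x, ∑ y, rowPairLaw P n x y * f x y =
      ∑ z, chain (fun s t : S × S => P (s.1, t.1, s.2, t.2)) (margAC P) n z *
        f (fun i => (z i).1) fun i => (z i).2 := by
  rw [← Fintype.sum_prod_type',
    ← (Equiv.arrowProdEquivProdArrow (Fin (n + 1)) (fun _ => S) fun _ => S).sum_comp]
  rfl

lemma sum_rowPairLaw_mul_fst (hP : ∀ p, 0 ≤ P p) (hL : CL P) (hM : CM P)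
    (f : (Fin (n + 1) → S) → ℝ) :
    ∑ x, ∑ y, rowPairLaw P n x y * f x = ∑ x, rowLaw P n x * f x := by
  rw [sum_rowPairLaw_mul fun x _ => f x]
  refine (hL.isStationaryPair_col hP).sum_chain_mul_comp_of_backward
    (hL.isStationaryPair_row hP) Prod.fst (fun g => ?_) (fun t ht g => ?_) n f
  · simp only [Fintype.sum_prod_type, ← sum_mul, sum_margAC]
  · obtain ⟨b, d⟩ := t
    simp only [Fintype.sum_prod_type, ← sum_mul, ← sum_div]
    refine sum_congr rfl fun a _ => ?_
    have hb : margA P b ≠ 0 := by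
      have h0 := (hL.isStationaryPair_col hP).marginal_nonneg
      rw [← sum_margAC]
      exact (sum_pos' (fun d _ => h0 _) ⟨d, mem_univ d, (h0 _).lt_of_ne' ht⟩).ne'
    congr 1
    rw [div_eq_div_iff ht hb]
    exact hL.margABD_mul hP hM a b d

lemma sum_rowPairLaw_mul_snd (hP : ∀ p, 0 ≤ P p) (hL : CL P) (hM : CM P)
    (f : (Fin (n + 1) → S) → ℝ) :
    ∑ x, ∑ y, rowPairLaw P n x y * f y = ∑ x, rowLaw P n x * f x := by
  rw [sum_rowPairLaw_mul fun _ y => f y]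
  refine (hL.isStationaryPair_col hP).sum_chain_mul_comp_of_forward
    Prod.snd (fun g => ?_) (fun s hs g => ?_) n f
  · simp only [Fintype.sum_prod_type]
    rw [sum_comm]
    simp only [← sum_mul, hL.sum_margAC_left]
  · obtain ⟨a, c⟩ := s
    simp only [Fintype.sum_prod_type]
    rw [sum_comm]
    simp only [← sum_mul, ← sum_div]
    refine sum_congr rfl fun d _ => ?_
    have hc : margA P c ≠ 0 := by
      have h0 := (hL.isStationaryPair_col hP).marginal_nonneg
      rw [← hL.sum_margAC_left]
      exact (sum_pos' (fun a _ => h0 (a, c)) ⟨a, mem_univ a, (h0 _).lt_of_ne' hs⟩).ne'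
    congr 1
    rw [div_eq_div_iff hs hc]
    exact (hL.margACD_mul hP hM a c d).trans (mul_comm _ _)

lemma rowPairLaw_pos (hP : IsProbDist P) (hL : CL P) {x y : Fin (n + 1 + 1) → S}
    (h : ∀ i : Fin (n + 1), 0 < P (x i.castSucc, x i.succ, y i.castSucc, y i.succ)) :
    0 < rowPairLaw P (n + 1) x y :=
  (hL.isStationaryPair_col hP.1).chain_pos h

lemma isStationaryPair_rowPairLaw [DecidableEq S] (hP : ∀ p, 0 ≤ P p) (hL : CL P) (hM : CM P) :
    IsStationaryPair (rowPairLaw P n) (rowLaw P n) where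
  nonneg _ _ := (hL.isStationaryPair_col hP).chain_nonneg _ _
  sum_right x := by
    have := sum_rowPairLaw_mul_fst (n := n) hP hL hM (Pi.single x 1)
    simp only [← sum_mul] at this
    simpa [Pi.single_apply] using this
  sum_left y := by
    have := sum_rowPairLaw_mul_snd (n := n) hP hL hM (Pi.single y 1)
    rw [sum_comm] at this
    simp only [← sum_mul] at this
    simpa [Pi.single_apply] using this

end TwoRows

section Grid

variable {S : Type*} [Fintype S]

/-- A law of configurations whose rows form a Markov chain. -/
noncomputable def gridLaw (P : S × S × S × S → ℝ) (n m : ℕ)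
    (ω : Fin (n + 1) × Fin (m + 1) → S) : ℝ :=
  chain (rowPairLaw P n) (rowLaw P n) m fun j i => ω (i, j)

variable {P : S × S × S × S → ℝ} {n m : ℕ}

lemma sum_gridLaw_mul (f : (Fin (m + 1) → Fin (n + 1) → S) → ℝ) :
    ∑ ω, gridLaw P n m ω * f (fun j i => ω (i, j)) =
      ∑ x, chain (rowPairLaw P n) (rowLaw P n) m x * f x := by
  rw [← (((Equiv.prodComm _ _).arrowCongr (Equiv.refl S)).trans
    (Equiv.curry (Fin (m + 1)) (Fin (n + 1)) S)).sum_comp]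
  rfl

variable [DecidableEq S]

lemma Consistent.sum_mul_cluster {N M : ℕ} {Q : (Fin N × Fin M → S) → ℝ} (h : Consistent Q P)
    (i : Fin (N - 1)) (j : Fin (M - 1)) (f : S × S × S × S → ℝ) :
    ∑ ω, Q ω * f (cluster ω i j) = ∑ p, P p * f p := by
  rw [← h i j]
  simp only [marginalAt, sum_mul]
  rw [sum_comm]
  simp [ite_mul]

lemma Consistent.pos {N M : ℕ} {Q : (Fin N × Fin M → S) → ℝ} (h : Consistent Q P)
    (hQ : ∀ ω, 0 ≤ Q ω) {ω : Fin N × Fin M → S} (hω : 0 < Q ω)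
    (i : Fin (N - 1)) (j : Fin (M - 1)) : 0 < P (cluster ω i j) := by
  rw [← h i j]
  refine sum_pos' (fun ω' _ => ?_) ⟨ω, mem_univ ω, by simpa using hω⟩
  split_ifs
  exacts [hQ ω', le_rfl]

lemma isProbDist_gridLaw (hP : IsProbDist P) (hL : CL P) (hM : CM P) :
    IsProbDist (gridLaw P n m) := by
  refine ⟨fun ω => (isStationaryPair_rowPairLaw hP.1 hL hM).chain_nonneg _ _, ?_⟩
  have h1 := sum_gridLaw_mul (P := P) (n := n) (m := m) fun _ => 1
  have h2 := (isStationaryPair_rowPairLaw (n := n) hP.1 hL hM).sum_chain_mul_first m fun _ => 1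
  have h3 := (hL.isStationaryPair_row hP.1).sum_chain_mul_first n fun _ => 1
  have h4 := sum_mul_margA (P := P) fun _ => 1
  simp only [mul_one] at h1 h2 h3 h4
  rw [h1, h2, ← hP.2, h4, ← h3]
  rfl

lemma consistent_gridLaw (hP : IsProbDist P) (hL : CL P) (hM : CM P) :
    Consistent (gridLaw P n m) P := by
  intro (i : Fin n) (j : Fin m)
  funext p
  have h1 := sum_gridLaw_mul (P := P) (n := n) (m := m) fun x =>
    if (x j.castSucc i.castSucc, x j.castSucc i.succ, x j.succ i.castSucc, x j.succ i.succ) = p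
      then 1 else 0
  rw [(isStationaryPair_rowPairLaw hP.1 hL hM).sum_chain_mul_pair m j fun x y =>
    if (x i.castSucc, x i.succ, y i.castSucc, y i.succ) = p then 1 else 0,
    sum_rowPairLaw_mul fun x y =>
    if (x i.castSucc, x i.succ, y i.castSucc, y i.succ) = p then 1 else 0,
    (hL.isStationaryPair_col hP.1).sum_chain_mul_pair n i fun s t =>
    if (s.1, t.1, s.2, t.2) = p then 1 else 0] at h1
  trans ∑ a, ∑ c, ∑ b, ∑ d, P (a, b, c, d) * if (a, b, c, d) = p then 1 else 0
  · simp only [Fintype.sum_prod_type] at h1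
    rw [← h1]
    refine sum_congr rfl fun ω _ => ?_
    rw [mul_ite, mul_one, mul_zero]
    rfl
  · trans ∑ q, P q * if q = p then 1 else 0
    · simp only [Fintype.sum_prod_type]
      exact sum_congr rfl fun _ _ => sum_comm
    · simp

variable {Q : (Fin (n + 1 + 1) × Fin (m + 1 + 1) → S) → ℝ}

lemma Consistent.gridLaw_pos (hP : IsProbDist P) (hL : CL P) (hM : CM P) (h : Consistent Q P)
    (hQ : ∀ ω, 0 ≤ Q ω) {ω : Fin (n + 1 + 1) × Fin (m + 1 + 1) → S} (hω : 0 < Q ω) :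
    0 < gridLaw P (n + 1) (m + 1) ω :=
  (isStationaryPair_rowPairLaw hP.1 hL hM).chain_pos fun j =>
    rowPairLaw_pos hP hL fun i => h.pos hQ hω i j

lemma Consistent.mul_log_gridLaw (hP : IsProbDist P) (hL : CL P) (hM : CM P) (h : Consistent Q P)
    (hQ : ∀ ω, 0 ≤ Q ω) (ω : Fin (n + 1 + 1) × Fin (m + 1 + 1) → S) :
    Q ω * Real.log (gridLaw P (n + 1) (m + 1) ω) =
      Q ω * Real.log (margA P (cluster ω (0 : Fin (n + 1)) (0 : Fin (m + 1))).1)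
      + ∑ i : Fin (n + 1), (Q ω * Real.log (margAB P ((cluster ω i (0 : Fin (m + 1))).1,
          (cluster ω i (0 : Fin (m + 1))).2.1))
        - Q ω * Real.log (margA P (cluster ω i (0 : Fin (m + 1))).1))
      + ∑ j : Fin (m + 1), (Q ω * Real.log (margAC P ((cluster ω (0 : Fin (n + 1)) j).1,
          (cluster ω (0 : Fin (n + 1)) j).2.2.1))
        + ∑ i : Fin (n + 1), (Q ω * Real.log (P (cluster ω i j))
          - Q ω * Real.log (margAC P ((cluster ω i j).1, (cluster ω i j).2.2.1)))
        - (Q ω * Real.log (margA P (cluster ω (0 : Fin (n + 1)) j).1)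
          + ∑ i : Fin (n + 1), (Q ω * Real.log (margAB P ((cluster ω i j).1, (cluster ω i j).2.1))
            - Q ω * Real.log (margA P (cluster ω i j).1)))) := by
  rcases (hQ ω).eq_or_lt with h0 | h0
  · simp [← h0]
  have hpos := h.pos hQ h0
  simp only [← mul_sub, ← mul_add, ← mul_sum]
  congr 1
  have hrow : ∀ j : Fin (m + 1),
      Real.log (rowLaw P (n + 1) fun i => ω (i, j.castSucc)) = _ := fun j =>
    (hL.isStationaryPair_row hP.1).log_chain fun i => margAB_pos hP (hpos i j)
  have hcol : ∀ j : Fin (m + 1), Real.log (rowPairLaw P (n + 1)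
      (fun i => ω (i, j.castSucc)) fun i => ω (i, j.succ)) = _ := fun j =>
    (hL.isStationaryPair_col hP.1).log_chain fun i => hpos i j
  rw [gridLaw, (isStationaryPair_rowPairLaw hP.1 hL hM).log_chain fun j =>
    rowPairLaw_pos hP hL fun i => hpos i j]
  simp only [hrow, hcol]
  congr 1
  exact hrow 0

/-- The cross entropy of a consistent law relative to `gridLaw` only depends on `P`. -/
lemma Consistent.sum_mul_log_gridLaw (hP : IsProbDist P) (hL : CL P) (hM : CM P)
    (h : Consistent Q P) (hQ : ∀ ω, 0 ≤ Q ω) :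
    -∑ ω, Q ω * Real.log (gridLaw P (n + 1) (m + 1) ω) =
      entropy (margA P) + (n + 1) * (entropy (margAB P) - entropy (margA P))
      + (m + 1) * (entropy (margAC P) + (n + 1) * (entropy P - entropy (margAC P))
        - (entropy (margA P) + (n + 1) * (entropy (margAB P) - entropy (margA P)))) := by
  have e0 : ∀ (i : Fin (n + 1)) (j : Fin (m + 1)),
      ∑ ω, Q ω * Real.log (P (cluster ω i j)) = -entropy P := fun i j => by
    rw [h.sum_mul_cluster i j fun p => Real.log (P p), entropy, neg_neg]
  have e1 : ∀ (i : Fin (n + 1)) (j : Fin (m + 1)),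
      ∑ ω, Q ω * Real.log (margA P (cluster ω i j).1) = -entropy (margA P) := fun i j => by
    rw [h.sum_mul_cluster i j fun p => Real.log (margA P p.1), entropy, neg_neg,
      sum_mul_margA fun a => Real.log (margA P a)]
  have e2 : ∀ (i : Fin (n + 1)) (j : Fin (m + 1)),
      ∑ ω, Q ω * Real.log (margAB P ((cluster ω i j).1, (cluster ω i j).2.1)) =
        -entropy (margAB P) := fun i j => by
    rw [h.sum_mul_cluster i j fun p => Real.log (margAB P (p.1, p.2.1)), entropy, neg_neg,
      sum_mul_margAB fun a b => Real.log (margAB P (a, b))]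
  have e3 : ∀ (i : Fin (n + 1)) (j : Fin (m + 1)),
      ∑ ω, Q ω * Real.log (margAC P ((cluster ω i j).1, (cluster ω i j).2.2.1)) =
        -entropy (margAC P) := fun i j => by
    rw [h.sum_mul_cluster i j fun p => Real.log (margAC P (p.1, p.2.2.1)), entropy, neg_neg,
      sum_mul_margAC fun a b => Real.log (margAC P (a, b))]
  have hc : ∀ (k : ℕ) (F : Fin k → (Fin (n + 1 + 1) × Fin (m + 1 + 1) → S) → ℝ),
      ∑ ω, ∑ i, F i ω = ∑ i, ∑ ω, F i ω := fun k F => sum_comm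
  simp only [h.mul_log_gridLaw hP hL hM hQ, sum_add_distrib, sum_sub_distrib, hc]
  simp only [e0, e1, e2, e3, sum_const, card_univ, Fintype.card_fin,
    nsmul_eq_mul]
  push_cast
  ring

end Grid

/-- Theorem 2 of the paper: the maximum entropy over probability
distributions on `N × M` configurations consistent with a marginal `P` obeying `C_L` and
`C_M` exists and equals
`(N−1)(M−1)·H(P) + (N−2)(M−2)·H(P_a) − (N−2)(M−1)·H(P_ac) − (N−1)(M−2)·H(P_ab)`. -/
theorem maxEntropy_of_consistent
    {S : Type*} [Fintype S] [DecidableEq S] [Nonempty S]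
    (P : S × S × S × S → ℝ) (hP : IsProbDist P) (hCL : CL P) (hCM : CM P)
    (N M : ℕ) (hN : 2 ≤ N) (hM : 2 ≤ M) :
    IsGreatest
      {h : ℝ | ∃ Q : (Fin N × Fin M → S) → ℝ,
        IsProbDist Q ∧ Consistent Q P ∧ h = entropy Q}
      (((N : ℝ) - 1) * ((M : ℝ) - 1) * entropy P
        + ((N : ℝ) - 2) * ((M : ℝ) - 2) * entropy (margA P)
        - ((N : ℝ) - 2) * ((M : ℝ) - 1) * entropy (margAC P)
        - ((N : ℝ) - 1) * ((M : ℝ) - 2) * entropy (margAB P)) := by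
  obtain ⟨n, rfl⟩ : ∃ n, N = n + 1 + 1 := ⟨N - 2, by omega⟩
  obtain ⟨m, rfl⟩ : ∃ m, M = m + 1 + 1 := ⟨M - 2, by omega⟩
  have hG := isProbDist_gridLaw (n := n + 1) (m := m + 1) hP hCL hCM
  have hGc := consistent_gridLaw (n := n + 1) (m := m + 1) hP hCL hCM
  constructor
  · refine ⟨_, hG, hGc, ?_⟩
    rw [entropy.eq_1 (gridLaw P (n + 1) (m + 1)), hGc.sum_mul_log_gridLaw hP hCL hCM hG.1]
    push_cast
    ring
  · rintro _ ⟨Q, hQ, hQc, rfl⟩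
    refine (entropy_le_neg_sum_mul_log hQ.1 hG.1
      (fun ω => hQc.gridLaw_pos hP hCL hCM hQ.1) (hG.2.trans hQ.2.symm)).trans_eq ?_
    rw [hQc.sum_mul_log_gridLaw hP hCL hCM hQ.1]
    push_cast
    ring
end

section
/- Let S be a nonempty finite set, let P be a probability distribution on S^4 satisfying the constraints C_L and C_M, let N, M ≥ 2 be integers, and let Q be any probability distribution on configurations ω : {1,…,N}×{1,…,M} → S that is consistent with P. Then H(Q) ≤ (N−1)(M−1)·H(P) + (N−2)(M−2)·H(P_a) − (N−2)(M−1)·H(P_{ac}) − (N−1)(M−2)·H(P_{ab}). -/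
open Finset

section Observables

variable {Ω α β γ δ : Type*} [Fintype Ω]
  [DecidableEq α] [DecidableEq β] [DecidableEq γ] [DecidableEq δ]

/-- The law of the observable `f` under `Q`. -/
def pushforward (Q : Ω → ℝ) (f : Ω → β) : β → ℝ :=
  fun b => ∑ ω, if f ω = b then Q ω else 0

/-- The Shannon entropy of the observable `f` under `Q`. -/
noncomputable def obsEntropy (Q : Ω → ℝ) (f : Ω → β) : ℝ :=
  -∑ ω, Q ω * Real.log (pushforward Q f (f ω))

lemma sum_pushforward_mul [Fintype β] (Q : Ω → ℝ) (f : Ω → β) (F : β → ℝ) :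
    ∑ b, pushforward Q f b * F b = ∑ ω, Q ω * F (f ω) := by
  simp only [pushforward, sum_mul, ite_mul, zero_mul]
  rw [sum_comm]
  simp

lemma entropy_pushforward [Fintype β] (Q : Ω → ℝ) (f : Ω → β) :
    entropy (pushforward Q f) = obsEntropy Q f := by
  simp only [entropy, obsEntropy, sum_pushforward_mul]

lemma pushforward_pushforward [Fintype β] (Q : Ω → ℝ) (f : Ω → β) (φ : β → γ) :
    pushforward (pushforward Q f) φ = pushforward Q (fun ω => φ (f ω)) := by
  ext c
  have := sum_pushforward_mul Q f (fun b => if φ b = c then 1 else 0)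
  simpa [pushforward] using this

lemma obsEntropy_pushforward [Fintype β] (Q : Ω → ℝ) (f : Ω → β) (φ : β → γ) :
    obsEntropy (pushforward Q f) φ = obsEntropy Q (fun ω => φ (f ω)) := by
  simp only [obsEntropy, pushforward_pushforward, sum_pushforward_mul]

/-- The entropy of an observable only depends on the partition it induces. -/
lemma obsEntropy_congr (Q : Ω → ℝ) {f : Ω → β} {g : Ω → γ}
    (h : ∀ ω ω', f ω = f ω' ↔ g ω = g ω') : obsEntropy Q f = obsEntropy Q g := by
  simp only [obsEntropy, pushforward, h]

lemma IsProbDist.pushforward [Fintype β] {Q : Ω → ℝ} (hQ : IsProbDist Q) (f : Ω → β) :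
    IsProbDist (pushforward Q f) := by
  refine ⟨fun b => sum_nonneg fun ω _ => ?_, ?_⟩
  · split_ifs
    exacts [hQ.1 ω, le_rfl]
  · simpa [hQ.2] using sum_pushforward_mul Q f (fun _ => 1)

lemma le_pushforward {Q : Ω → ℝ} (hQ : IsProbDist Q) (f : Ω → β) (ω : Ω) :
    Q ω ≤ pushforward Q f (f ω) := by
  have := single_le_sum (f := fun ω' => if f ω' = f ω then Q ω' else 0) (s := univ)
    (fun ω' _ => by split_ifs; exacts [hQ.1 ω', le_rfl]) (mem_univ ω)
  simpa [pushforward] using this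

lemma sum_pushforward_prodMk [Fintype α] (Q : Ω → ℝ) (f : Ω → α) (g : Ω → β) (b : β) :
    ∑ a, pushforward Q (fun ω => (f ω, g ω)) (a, b) = pushforward Q g b := by
  simp only [pushforward, Prod.mk.injEq, ite_and]
  rw [sum_comm]
  simp

lemma obsEntropy_const {Q : Ω → ℝ} (hQ : IsProbDist Q) (b : β) :
    obsEntropy Q (fun _ => b) = 0 := by
  simp [obsEntropy, pushforward, hQ.2]

lemma obsEntropy_id_sub_le [Fintype α] [Fintype γ] [Fintype δ] {p : α × γ → ℝ}
    (hp : IsProbDist p) (κ : γ → δ) :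
    obsEntropy p (fun x => x) - obsEntropy p (fun x => x.2) ≤
      obsEntropy p (fun x => (x.1, κ x.2)) - obsEntropy p (fun x => κ x.2) := by
  set G := pushforward p (fun x => x.2) with hG
  set K := pushforward p (fun x => κ x.2) with hK
  set F := pushforward p (fun x => (x.1, κ x.2)) with hF
  have hid : pushforward p (fun x => x) = p := by ext x; simp [pushforward]
  have hGp : IsProbDist G := hp.pushforward _
  have hKp : IsProbDist K := hp.pushforward _
  have hFp : IsProbDist F := hp.pushforward _
  have term : ∀ x, p x * Real.log (G x.2) + p x * Real.log (F (x.1, κ x.2))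
      - p x * Real.log (p x) - p x * Real.log (K (κ x.2)) ≤
      G x.2 * F (x.1, κ x.2) / K (κ x.2) - p x := by
    intro x
    rcases (hp.1 x).eq_or_lt with h0 | h0
    · rw [← h0]
      have := div_nonneg (mul_nonneg (hGp.1 x.2) (hFp.1 (x.1, κ x.2))) (hKp.1 (κ x.2))
      simpa using this
    · have g0 : 0 < G x.2 := h0.trans_le (le_pushforward hp (fun x => x.2) x)
      have k0 : 0 < K (κ x.2) := h0.trans_le (le_pushforward hp (fun x => κ x.2) x)
      have f0 : 0 < F (x.1, κ x.2) := h0.trans_le (le_pushforward hp (fun x => (x.1, κ x.2)) x)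
      have hlog := Real.log_le_sub_one_of_pos
        (show 0 < G x.2 * F (x.1, κ x.2) / (p x * K (κ x.2)) by positivity)
      rw [Real.log_div (by positivity) (by positivity), Real.log_mul g0.ne' f0.ne',
        Real.log_mul h0.ne' k0.ne'] at hlog
      have := mul_le_mul_of_nonneg_left hlog h0.le
      have e : p x * (G x.2 * F (x.1, κ x.2) / (p x * K (κ x.2)) - 1) =
          G x.2 * F (x.1, κ x.2) / K (κ x.2) - p x := by
        field_simp
      linarith
  have bound : ∑ x : α × γ, G x.2 * F (x.1, κ x.2) / K (κ x.2) ≤ 1 := by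
    rw [Fintype.sum_prod_type_right, ← hGp.2]
    refine sum_le_sum fun y _ => ?_
    dsimp only
    rw [← sum_div, ← mul_sum, hF, sum_pushforward_prodMk, ← hK, mul_div_assoc]
    exact mul_le_of_le_one_right (hGp.1 y) (div_self_le_one _)
  have total := sum_le_sum fun x (_ : x ∈ univ) => term x
  simp only [sum_sub_distrib, sum_add_distrib, hp.2] at total
  simp only [obsEntropy, hid]
  linarith

/-- Conditioning on a function of `g` instead of `g` does not decrease the conditional entropy. -/
lemma obsEntropy_prodMk_sub_le [Fintype α] [Fintype γ] [Fintype δ] {Q : Ω → ℝ}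
    (hQ : IsProbDist Q) (f : Ω → α) (g : Ω → γ) (κ : γ → δ) :
    obsEntropy Q (fun ω => (f ω, g ω)) - obsEntropy Q g ≤
      obsEntropy Q (fun ω => (f ω, κ (g ω))) - obsEntropy Q (fun ω => κ (g ω)) := by
  simpa only [obsEntropy_pushforward] using
    obsEntropy_id_sub_le (hQ.pushforward fun ω => (f ω, g ω)) κ

end Observables

section ClusterMarginals

variable {S : Type*} [Fintype S] [DecidableEq S]

lemma margAB_eq_pushforward (P : S × S × S × S → ℝ) :
    margAB P = pushforward P (fun q => (q.1, q.2.1)) := by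
  ext ⟨a, b⟩
  simp only [pushforward, Fintype.sum_prod_type]
  change _ = ∑ x, ∑ y, ∑ z, ∑ w, if (x, y) = (a, b) then P (x, y, z, w) else 0
  simp [margAB, ite_and, sum_ite_irrel]

lemma margAC_eq_pushforward (P : S × S × S × S → ℝ) :
    margAC P = pushforward P (fun q => (q.1, q.2.2.1)) := by
  ext ⟨a, b⟩
  simp only [pushforward, Fintype.sum_prod_type]
  change _ = ∑ x, ∑ y, ∑ z, ∑ w, if (x, z) = (a, b) then P (x, y, z, w) else 0
  simp [margAC, ite_and, sum_ite_irrel]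

lemma margBD_eq_pushforward (P : S × S × S × S → ℝ) :
    margBD P = pushforward P (fun q => (q.2.1, q.2.2.2)) := by
  ext ⟨a, b⟩
  simp only [pushforward, Fintype.sum_prod_type]
  change _ = ∑ x, ∑ y, ∑ z, ∑ w, if (y, w) = (a, b) then P (x, y, z, w) else 0
  simp [margBD, ite_and, sum_ite_irrel]

lemma margABD_eq_pushforward (P : S × S × S × S → ℝ) :
    margABD P = pushforward P (fun q => (q.1, q.2.1, q.2.2.2)) := by
  ext ⟨a, b, d⟩
  simp only [pushforward, Fintype.sum_prod_type]
  change _ = ∑ x, ∑ y, ∑ z, ∑ w, if (x, y, w) = (a, b, d) then P (x, y, z, w) else 0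
  simp [margABD, ite_and, sum_ite_irrel]

lemma margA_eq_pushforward (P : S × S × S × S → ℝ) :
    margA P = pushforward P (fun q => q.1) := by
  ext a
  simp only [pushforward, Fintype.sum_prod_type]
  change _ = ∑ x, ∑ y, ∑ z, ∑ w, if x = a then P (x, y, z, w) else 0
  simp [margA, sum_ite_irrel]

lemma CL.margA_eq_pushforward_right {P : S × S × S × S → ℝ} (h : CL P) :
    margA P = pushforward P (fun q => q.2.1) := by
  have h2 := h.2
  rw [margAC_eq_pushforward, margBD_eq_pushforward] at h2
  have := congrArg (fun R => pushforward R Prod.fst) h2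
  simpa only [pushforward_pushforward, margA_eq_pushforward] using this

end ClusterMarginals

section GridEntropy

variable {S : Type*} [Fintype S] [DecidableEq S] {N M : ℕ}

/-- The joint entropy of the sites in `s`. -/
noncomputable def siteEntropy {ι : Type*} [Fintype ι] [DecidableEq ι] (Q : (ι → S) → ℝ)
    (s : Finset ι) : ℝ :=
  obsEntropy Q (fun ω (x : s) => ω x)

lemma siteEntropy_insert_sub_le {ι γ : Type*} [Fintype ι] [DecidableEq ι] [Fintype γ]
    [DecidableEq γ] {Q : (ι → S) → ℝ} (hQ : IsProbDist Q) (s : Finset ι) (a : ι)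
    (κ : (s → S) → γ) :
    siteEntropy Q (insert a s) - siteEntropy Q s ≤
      obsEntropy Q (fun ω => (ω a, κ fun x => ω x)) - obsEntropy Q (fun ω => κ fun x => ω x) := by
  have h := obsEntropy_prodMk_sub_le hQ (fun ω => ω a) (fun ω (x : s) => ω x) κ
  have e : siteEntropy Q (insert a s) = obsEntropy Q (fun ω => (ω a, fun x : s => ω x)) := by
    refine obsEntropy_congr Q fun ω ω' => ?_
    simp [funext_iff]
  rw [e]
  exact h

/-- The position of a site in the scan that runs through the rows from bottom to top, and through
each row from right to left. -/
def scanPos (x : Fin N × Fin M) : Fin M ×ₗ (Fin N)ᵒᵈ :=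
  toLex (x.2, OrderDual.toDual x.1)

lemma scanPos_lt {x y : Fin N × Fin M} :
    scanPos x < scanPos y ↔ x.2 < y.2 ∨ x.2 = y.2 ∧ y.1 < x.1 := by
  simp [scanPos, Prod.Lex.toLex_lt_toLex]

lemma scanPos_injective : Function.Injective (scanPos (N := N) (M := M)) := by
  rintro ⟨i, j⟩ ⟨i', j'⟩ h
  simp only [scanPos, EmbeddingLike.apply_eq_iff_eq, Prod.mk.injEq] at h
  simp [h.1, h.2]

/-- The upper bound on the entropy of the site `x` given the sites scanned before it. -/
noncomputable def scanIncrement (P : S × S × S × S → ℝ) (x : Fin N × Fin M) : ℝ :=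
  if x.2.1 = 0 then
    if x.1.1 + 1 = N then entropy (margA P) else entropy (margAB P) - entropy (margA P)
  else
    if x.1.1 + 1 = N then entropy (margAC P) - entropy (margA P)
    else entropy P + entropy (margA P) - entropy (margAC P) - entropy (margAB P)

lemma siteEntropy_insert_sub_le_scanIncrement {P : S × S × S × S → ℝ} (hCL : CL P) (hCM : CM P)
    (hN : 2 ≤ N) (hM : 2 ≤ M) {Q : (Fin N × Fin M → S) → ℝ} (hQ : IsProbDist Q)
    (hQP : Consistent Q P) (s : Finset (Fin N × Fin M)) (x : Fin N × Fin M)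
    (hs : ∀ y, scanPos y < scanPos x → y ∈ s) :
    siteEntropy Q (insert x s) - siteEntropy Q s ≤ scanIncrement P x := by
  have hcl : ∀ i j, pushforward Q (fun ω => cluster ω i j) = P := hQP
  have hP : ∀ i j, entropy P = obsEntropy Q (fun ω => cluster ω i j) := fun i j => by
    rw [← entropy_pushforward, hcl]
  have hA : ∀ i j, entropy (margA P) = obsEntropy Q (fun ω => (cluster ω i j).2.1) := fun i j => by
    rw [hCL.margA_eq_pushforward_right, entropy_pushforward, ← hcl i j, obsEntropy_pushforward]
  have hAB : ∀ i j, entropy (margAB P) =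
      obsEntropy Q (fun ω => ((cluster ω i j).1, (cluster ω i j).2.1)) := fun i j => by
    rw [margAB_eq_pushforward, entropy_pushforward, ← hcl i j, obsEntropy_pushforward]
  have hAC : ∀ i j, entropy (margAC P) =
      obsEntropy Q (fun ω => ((cluster ω i j).2.1, (cluster ω i j).2.2.2)) := fun i j => by
    rw [hCL.2, margBD_eq_pushforward, entropy_pushforward, ← hcl i j, obsEntropy_pushforward]
  have hABD : ∀ i j, entropy (margABD P) =
      obsEntropy Q (fun ω => ((cluster ω i j).1, (cluster ω i j).2.1, (cluster ω i j).2.2.2)) :=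
    fun i j => by
      rw [margABD_eq_pushforward, entropy_pushforward, ← hcl i j, obsEntropy_pushforward]
  obtain ⟨⟨i, hi⟩, ⟨j, hj⟩⟩ := x
  unfold scanIncrement
  dsimp only
  split_ifs with hj0 hi1 hi1
  · subst hj0
    have h := siteEntropy_insert_sub_le hQ s (⟨i, hi⟩, ⟨0, hj⟩) (fun _ => ())
    rw [obsEntropy_const hQ, sub_zero] at h
    refine h.trans_eq ?_
    rw [hA ⟨N - 2, by omega⟩ ⟨0, by omega⟩]
    refine obsEntropy_congr Q fun ω ω' => ?_
    have : i = N - 2 + 1 := by omega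
    subst this
    simp [cluster]
  · subst hj0
    have hb : ((⟨i + 1, by omega⟩, ⟨0, hj⟩) : Fin N × Fin M) ∈ s := hs _ (by simp [scanPos_lt])
    have h := siteEntropy_insert_sub_le hQ s (⟨i, hi⟩, ⟨0, hj⟩) (fun η => η ⟨_, hb⟩)
    rw [hA ⟨i, by omega⟩ ⟨0, by omega⟩, hAB ⟨i, by omega⟩ ⟨0, by omega⟩]
    exact h
  · obtain ⟨j, rfl⟩ := Nat.exists_eq_succ_of_ne_zero hj0
    obtain ⟨i, rfl⟩ : ∃ k, i = k + 1 := ⟨i - 1, by omega⟩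
    have hb : ((⟨i + 1, hi⟩, ⟨j, by omega⟩) : Fin N × Fin M) ∈ s := hs _ (by simp [scanPos_lt])
    have h := siteEntropy_insert_sub_le hQ s (⟨i + 1, hi⟩, ⟨j + 1, hj⟩) (fun η => η ⟨_, hb⟩)
    rw [hA ⟨i, by omega⟩ ⟨j, by omega⟩, hAC ⟨i, by omega⟩ ⟨j, by omega⟩]
    refine h.trans_eq (congrArg (· - _) (obsEntropy_congr Q fun ω ω' => ?_))
    simp only [cluster, Prod.mk.injEq]
    exact and_comm
  · obtain ⟨j, rfl⟩ := Nat.exists_eq_succ_of_ne_zero hj0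
    have ha : ((⟨i, hi⟩, ⟨j, by omega⟩) : Fin N × Fin M) ∈ s := hs _ (by simp [scanPos_lt])
    have hb : ((⟨i + 1, by omega⟩, ⟨j, by omega⟩) : Fin N × Fin M) ∈ s :=
      hs _ (by simp [scanPos_lt])
    have hd : ((⟨i + 1, by omega⟩, ⟨j + 1, hj⟩) : Fin N × Fin M) ∈ s := hs _ (by simp [scanPos_lt])
    have h := siteEntropy_insert_sub_le hQ s (⟨i, hi⟩, ⟨j + 1, hj⟩)
      (fun η => (η ⟨_, ha⟩, η ⟨_, hb⟩, η ⟨_, hd⟩))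
    have e : entropy P + entropy (margA P) - entropy (margAC P) - entropy (margAB P) =
        entropy P - entropy (margABD P) := by linarith [hCM.1]
    rw [e, hP ⟨i, by omega⟩ ⟨j, by omega⟩, hABD ⟨i, by omega⟩ ⟨j, by omega⟩]
    refine h.trans_eq (congrArg (· - _) (obsEntropy_congr Q fun ω ω' => ?_))
    simp only [cluster, Prod.mk.injEq]
    tauto

lemma siteEntropy_le_sum_scanIncrement {P : S × S × S × S → ℝ} (hCL : CL P) (hCM : CM P)
    (hN : 2 ≤ N) (hM : 2 ≤ M) {Q : (Fin N × Fin M → S) → ℝ} (hQ : IsProbDist Q)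
    (hQP : Consistent Q P) (s : Finset (Fin N × Fin M))
    (hs : ∀ x ∈ s, ∀ y, scanPos y < scanPos x → y ∈ s) :
    siteEntropy Q s ≤ ∑ x ∈ s, scanIncrement P x := by
  induction s using Finset.induction_on_max_value scanPos with
  | empty =>
    rw [sum_empty, siteEntropy, ← obsEntropy_const hQ ()]
    exact (obsEntropy_congr Q fun ω ω' => by simp [funext_iff]).le
  | insert a s ha hmax ih =>
    have hlt : ∀ x ∈ s, scanPos x < scanPos a := fun x hx =>
      (hmax x hx).lt_of_ne fun h => ha (scanPos_injective h ▸ hx)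
    have hlow : ∀ x ∈ s, ∀ y, scanPos y < scanPos x → y ∈ s := fun x hx y hy =>
      (mem_insert.1 (hs x (mem_insert_of_mem hx) y hy)).resolve_left fun h =>
        (hy.trans (hlt x hx)).ne (congrArg scanPos h)
    have hpast : ∀ y, scanPos y < scanPos a → y ∈ s := fun y hy =>
      (mem_insert.1 (hs a (mem_insert_self a s) y hy)).resolve_left fun h =>
        hy.ne (congrArg scanPos h)
    rw [sum_insert ha]
    linarith [ih hlow, siteEntropy_insert_sub_le_scanIncrement hCL hCM hN hM hQ hQP s a hpast]

end GridEntropy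

lemma sum_scanIncrement {S : Type*} [Fintype S] {N M : ℕ}
    (P : S × S × S × S → ℝ) (hN : 2 ≤ N) (hM : 2 ≤ M) :
    ∑ x : Fin N × Fin M, scanIncrement P x =
      ((N : ℝ) - 1) * ((M : ℝ) - 1) * entropy P
        + ((N : ℝ) - 2) * ((M : ℝ) - 2) * entropy (margA P)
        - ((N : ℝ) - 2) * ((M : ℝ) - 1) * entropy (margAC P)
        - ((N : ℝ) - 1) * ((M : ℝ) - 2) * entropy (margAB P) := by
  obtain ⟨n, rfl⟩ : ∃ n, N = n + 1 := ⟨N - 1, by omega⟩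
  obtain ⟨m, rfl⟩ : ∃ m, M = m + 1 := ⟨M - 1, by omega⟩
  have hne : ∀ i : Fin n, (i : ℕ) ≠ n := fun i => i.isLt.ne
  simp only [scanIncrement, Fintype.sum_prod_type, Fin.sum_univ_castSucc (n := n),
    Fin.sum_univ_succ (n := m)]
  simp [hne]
  ring

/-- any probability distribution on `N × M` configurations consistent with
a marginal `P` obeying `C_L` and `C_M` has entropy at most
`(N−1)(M−1)·H(P) + (N−2)(M−2)·H(P_a) − (N−2)(M−1)·H(P_ac) − (N−1)(M−2)·H(P_ab)`. -/
theorem entropy_le_of_consistent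
    {S : Type*} [Fintype S] [DecidableEq S] [Nonempty S]
    (P : S × S × S × S → ℝ) (hP : IsProbDist P) (hCL : CL P) (hCM : CM P)
    (N M : ℕ) (hN : 2 ≤ N) (hM : 2 ≤ M)
    (Q : (Fin N × Fin M → S) → ℝ) (hQ : IsProbDist Q) (hQP : Consistent Q P) :
    entropy Q ≤
      ((N : ℝ) - 1) * ((M : ℝ) - 1) * entropy P
        + ((N : ℝ) - 2) * ((M : ℝ) - 2) * entropy (margA P)
        - ((N : ℝ) - 2) * ((M : ℝ) - 1) * entropy (margAC P)
        - ((N : ℝ) - 1) * ((M : ℝ) - 2) * entropy (margAB P) := by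
  have h := siteEntropy_le_sum_scanIncrement hCL hCM hN hM hQ hQP univ (fun _ _ y _ => mem_univ y)
  have e : siteEntropy Q univ = entropy Q := by
    have hid : pushforward Q (fun ω => ω) = Q := by ext; simp [pushforward]
    rw [← hid, entropy_pushforward, hid]
    exact obsEntropy_congr Q fun ω ω' => by simp [funext_iff]
  rwa [e, sum_scanIncrement P hN hM] at h
end

section
/- Let S be a nonempty finite set, let P be a probability distribution on S^4 satisfying the constraints C_L and C_M, and let N, M ≥ 3 be integers. Then the explicitly constructed function Q_{N,M} on configurations ω : {1,…,N}×{1,…,M} → S is a probability distribution (it is nonnegative and sums to 1) and is consistent with P: for all 1 ≤ i ≤ N−1, 1 ≤ j ≤ M−1, the pushforward of Q_{N,M} under ω ↦ (ω(i,j), ω(i+1,j), ω(i,j+1), ω(i+1,j+1)) equals P. -/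
open Finset

section Ansatz

variable {S : Type*} [Fintype S] [DecidableEq S]

/-- Numerator of the ansatz distribution `Q_{N,M}`. -/
noncomputable def QNMnum (P : S × S × S × S → ℝ) (N M : ℕ) (ω : Fin N × Fin M → S) : ℝ :=
  (∏ i : Fin (N - 1), ∏ j : Fin (M - 1), P (cluster ω i j)) *
  ∏ i : Fin (N - 2), ∏ j : Fin (M - 2),
    margA P (ω (⟨i.1 + 1, by have := i.isLt; omega⟩, ⟨j.1 + 1, by have := j.isLt; omega⟩))

/-- Denominator of the ansatz distribution `Q_{N,M}`. -/
noncomputable def QNMden (P : S × S × S × S → ℝ) (N M : ℕ) (ω : Fin N × Fin M → S) : ℝ :=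
  (∏ i : Fin (N - 2), ∏ j : Fin (M - 1),
    margAC P (ω (⟨i.1 + 1, by have := i.isLt; omega⟩, ⟨j.1, by have := j.isLt; omega⟩),
              ω (⟨i.1 + 1, by have := i.isLt; omega⟩, ⟨j.1 + 1, by have := j.isLt; omega⟩))) *
  ∏ i : Fin (N - 1), ∏ j : Fin (M - 2),
    margAB P (ω (⟨i.1, by have := i.isLt; omega⟩, ⟨j.1 + 1, by have := j.isLt; omega⟩),
              ω (⟨i.1 + 1, by have := i.isLt; omega⟩, ⟨j.1 + 1, by have := j.isLt; omega⟩))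

open Classical in
/-- The explicitly constructed ansatz distribution `Q_{N,M}`, with the convention that it
vanishes whenever its numerator vanishes. -/
noncomputable def QNM (P : S × S × S × S → ℝ) (N M : ℕ) : (Fin N × Fin M → S) → ℝ :=
  fun ω => if QNMnum P N M ω = 0 then 0 else QNMnum P N M ω / QNMden P N M ω

/-- Numerator of the snake distribution. -/
noncomputable def snakeNum (P : S × S × S × S → ℝ) (N : ℕ) (x : Fin N × Fin 2 → S) : ℝ :=
  ∏ i : Fin (N - 1),
    P (x (⟨i.1, by have := i.isLt; omega⟩, 0), x (⟨i.1 + 1, by have := i.isLt; omega⟩, 0),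
       x (⟨i.1, by have := i.isLt; omega⟩, 1), x (⟨i.1 + 1, by have := i.isLt; omega⟩, 1))

/-- Denominator of the snake distribution. -/
noncomputable def snakeDen (P : S × S × S × S → ℝ) (N : ℕ) (x : Fin N × Fin 2 → S) : ℝ :=
  ∏ i : Fin (N - 2),
    margAC P (x (⟨i.1 + 1, by have := i.isLt; omega⟩, 0),
              x (⟨i.1 + 1, by have := i.isLt; omega⟩, 1))

open Classical in
/-- The snake distribution on two-row configurations, with the convention that it vanishes
whenever its numerator vanishes. -/
noncomputable def Snake (P : S × S × S × S → ℝ) (N : ℕ) : (Fin N × Fin 2 → S) → ℝ :=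
  fun x => if snakeNum P N x = 0 then 0 else snakeNum P N x / snakeDen P N x

end Ansatz

/-- A nonnegative pair weight `K` on `X × X` both of whose marginals equal `W`. -/
structure IsStationaryPair_s3 {X : Type*} [Fintype X] (K : X → X → ℝ) (W : X → ℝ) : Prop where
  nonneg : ∀ x y, 0 ≤ K x y
  sum_right : ∀ x, ∑ y, K x y = W x
  sum_left : ∀ y, ∑ x, K x y = W y

/-- The weight of a path of the stationary Markov chain with pair law `K` and one-site law `W`. -/
noncomputable def chainWeight {X : Type*} (K : X → X → ℝ) (W : X → ℝ) (n : ℕ)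
    (x : Fin (n + 1) → X) : ℝ :=
  W (x 0) * ∏ i : Fin n, K (x i.castSucc) (x i.succ) / W (x i.castSucc)

theorem chainWeight_eq_zero_of_first {X : Type*} {K : X → X → ℝ} {W : X → ℝ} {n : ℕ}
    {x : Fin (n + 1) → X} (hx : W (x 0) = 0) :
    chainWeight K W n x = 0 := by
  simp [chainWeight, hx]

theorem chainWeight_snoc {X : Type*} {K : X → X → ℝ} {W : X → ℝ} (n : ℕ)
    (x : Fin (n + 1) → X) (y : X) :
    chainWeight K W (n + 1) (Fin.snoc x y : Fin (n + 2) → X) =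
      chainWeight K W n x * (K (x (Fin.last n)) y / W (x (Fin.last n))) := by
  have h0 : (Fin.snoc x y : Fin (n + 2) → X) 0 = x 0 := by
    rw [← Fin.castSucc_zero, Fin.snoc_castSucc]
  simp only [chainWeight, Fin.prod_univ_castSucc (n := n), Fin.snoc_castSucc, h0, Fin.succ_last,
    Fin.snoc_last, ← Fin.castSucc_succ, mul_assoc]

theorem sum_fin_snoc {X : Type*} [Fintype X] (n : ℕ) (F : (Fin (n + 1) → X) → ℝ) :
    ∑ x, F x = ∑ x : Fin n → X, ∑ y : X, F (Fin.snoc x y : Fin (n + 1) → X) := by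
  rw [← (Fin.snocEquiv fun _ : Fin (n + 1) => X).sum_comp, Fintype.sum_prod_type,
    Finset.sum_comm]
  rfl

theorem sum_fin_cons {X : Type*} [Fintype X] (n : ℕ) (F : (Fin (n + 1) → X) → ℝ) :
    ∑ x, F x = ∑ x : Fin n → X, ∑ a : X, F (Fin.cons a x : Fin (n + 1) → X) := by
  rw [← (Fin.consEquiv fun _ : Fin (n + 1) => X).sum_comp, Fintype.sum_prod_type,
    Finset.sum_comm]
  rfl

section Chain

variable {X : Type*} [Fintype X] {K : X → X → ℝ} {W : X → ℝ}

namespace IsStationaryPair_s3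

theorem weight_nonneg (h : IsStationaryPair_s3 K W) (x : X) : 0 ≤ W x :=
  h.sum_right x ▸ Finset.sum_nonneg fun y _ => h.nonneg x y

theorem eq_zero_of_left_s3 (h : IsStationaryPair_s3 K W) {x : X} (hx : W x = 0) (y : X) :
    K x y = 0 := by
  have hs := h.sum_right x
  rw [hx, Finset.sum_eq_zero_iff_of_nonneg fun y _ => h.nonneg x y] at hs
  exact hs y (Finset.mem_univ y)

theorem eq_zero_of_right_s3 (h : IsStationaryPair_s3 K W) (x : X) {y : X} (hy : W y = 0) :
    K x y = 0 := by
  have hs := h.sum_left y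
  rw [hy, Finset.sum_eq_zero_iff_of_nonneg fun x _ => h.nonneg x y] at hs
  exact hs x (Finset.mem_univ x)

end IsStationaryPair_s3

theorem chainWeight_nonneg (h : IsStationaryPair_s3 K W) (n : ℕ) (x : Fin (n + 1) → X) :
    0 ≤ chainWeight K W n x :=
  mul_nonneg (h.weight_nonneg _) <| Finset.prod_nonneg fun _ _ =>
    div_nonneg (h.nonneg _ _) (h.weight_nonneg _)

theorem chainWeight_eq_zero_of_last (h : IsStationaryPair_s3 K W) {n : ℕ} {x : Fin (n + 1) → X}
    (hx : W (x (Fin.last n)) = 0) : chainWeight K W n x = 0 := by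
  cases n with
  | zero => exact chainWeight_eq_zero_of_first hx
  | succ n =>
    rw [chainWeight, Fin.prod_univ_castSucc, Fin.succ_last, h.eq_zero_of_right_s3 _ hx]
    simp

theorem chainWeight_cons (h : IsStationaryPair_s3 K W) (n : ℕ) (a : X) (x : Fin (n + 1) → X) :
    chainWeight K W (n + 1) (Fin.cons a x : Fin (n + 2) → X) =
      K a (x 0) / W (x 0) * chainWeight K W n x := by
  simp only [chainWeight, Fin.prod_univ_succ (n := n), Fin.cons_zero, Fin.cons_succ,
    Fin.castSucc_zero, ← Fin.succ_castSucc]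
  rw [← mul_assoc, ← mul_assoc]
  congr 1
  rcases eq_or_ne (W a) 0 with ha | ha
  · simp [ha, h.eq_zero_of_left_s3 ha]
  rcases eq_or_ne (W (x 0)) 0 with hx | hx
  · simp [hx, h.eq_zero_of_right_s3 _ hx]
  field_simp

theorem sum_chainWeight_snoc (h : IsStationaryPair_s3 K W) (n : ℕ) (x : Fin (n + 1) → X) :
    ∑ y, chainWeight K W (n + 1) (Fin.snoc x y : Fin (n + 2) → X) = chainWeight K W n x := by
  simp only [chainWeight_snoc]
  rw [← Finset.mul_sum, ← Finset.sum_div, h.sum_right]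
  rcases eq_or_ne (W (x (Fin.last n))) 0 with hx | hx
  · simp [chainWeight_eq_zero_of_last h hx]
  · rw [div_self hx, mul_one]

theorem sum_chainWeight_cons (h : IsStationaryPair_s3 K W) (n : ℕ) (x : Fin (n + 1) → X) :
    ∑ a, chainWeight K W (n + 1) (Fin.cons a x : Fin (n + 2) → X) = chainWeight K W n x := by
  simp only [chainWeight_cons h]
  rw [← Finset.sum_mul, ← Finset.sum_div, h.sum_left]
  rcases eq_or_ne (W (x 0)) 0 with hx | hx
  · simp [chainWeight_eq_zero_of_first hx]
  · rw [div_self hx, one_mul]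

/-- Every consecutive pair of the chain has law `K`. -/
theorem sum_chainWeight_mul_pair (h : IsStationaryPair_s3 K W) (n : ℕ) (i : Fin (n + 1))
    (f : X → X → ℝ) :
    ∑ x, chainWeight K W (n + 1) x * f (x i.castSucc) (x i.succ) = ∑ x, ∑ y, K x y * f x y := by
  induction n with
  | zero =>
    obtain rfl : i = 0 := by omega
    rw [sum_fin_cons, Finset.sum_comm]
    refine Finset.sum_congr rfl fun a _ => ?_
    refine Fintype.sum_equiv (Equiv.funUnique (Fin 1) X) _ _ fun x => ?_
    rw [chainWeight_cons h]
    rcases eq_or_ne (W (x 0)) 0 with hx | hx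
    · simp [hx, h.eq_zero_of_right_s3 _ hx]
    · simp [chainWeight, hx]
  | succ n ih =>
    refine Fin.cases ?_ (fun j => ?_) i
    · rw [sum_fin_snoc, ← ih 0]
      refine Finset.sum_congr rfl fun x _ => ?_
      rw [← sum_chainWeight_snoc h, Finset.sum_mul]
      refine Finset.sum_congr rfl fun y _ => ?_
      rw [← Fin.castSucc_zero (n := n + 1), ← Fin.castSucc_succ, Fin.snoc_castSucc,
        Fin.snoc_castSucc]
    · rw [sum_fin_cons, ← ih j]
      refine Finset.sum_congr rfl fun x _ => ?_
      rw [← sum_chainWeight_cons h, Finset.sum_mul]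
      refine Finset.sum_congr rfl fun y _ => ?_
      rw [← Fin.succ_castSucc, Fin.cons_succ, Fin.cons_succ]

theorem chainWeight_eq_prod_div_prod (h : IsStationaryPair_s3 K W) (n : ℕ)
    (x : Fin (n + 2) → X) :
    chainWeight K W (n + 1) x =
      (∏ i : Fin (n + 1), K (x i.castSucc) (x i.succ)) /
        ∏ i : Fin n, W (x i.succ.castSucc) := by
  rw [chainWeight, Finset.prod_div_distrib, Fin.prod_univ_succ (fun i => W (x i.castSucc)),
    Fin.castSucc_zero]
  rcases eq_or_ne (W (x 0)) 0 with hx | hx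
  · rw [hx, Fin.prod_univ_succ, Fin.castSucc_zero, h.eq_zero_of_left_s3 hx]
    simp
  · rw [← mul_div_assoc, mul_div_mul_left _ _ hx]

end Chain

section Lumping

variable {A B : Type*} [Fintype A] [Fintype B] {K : A × B → A × B → ℝ} {W : A × B → ℝ}

/-- If `c` is summed out of the transition `(a, b) → (c, d)` and the result depends on `a` only
through `b`, then the second component of the chain is a Markov chain. -/
theorem sum_chainWeight_fst (h : IsStationaryPair_s3 K W) {K' : B → B → ℝ} {W' : B → ℝ}
    (hW : ∀ b, ∑ a, W (a, b) = W' b)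
    (hK : ∀ a b d, (∑ c, K (a, b) (c, d)) * W' b = W (a, b) * K' b d)
    (n : ℕ) (v : Fin (n + 1) → B) :
    ∑ u : Fin (n + 1) → A, chainWeight K W n (fun i => (u i, v i)) = chainWeight K' W' n v := by
  induction n with
  | zero =>
    simp only [chainWeight, Finset.univ_eq_empty, Finset.prod_empty, mul_one, ← hW]
    exact Fintype.sum_equiv (Equiv.funUnique (Fin 1) A) _ _ fun _ => rfl
  | succ n ih =>
    obtain ⟨v, d, rfl⟩ : ∃ (v' : Fin (n + 1) → B) (d : B), v = Fin.snoc v' d :=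
      ⟨Fin.init v, v (Fin.last _), (Fin.snoc_init_self v).symm⟩
    rw [sum_fin_snoc, chainWeight_snoc, ← ih, Finset.sum_mul]
    refine Finset.sum_congr rfl fun u _ => ?_
    have hs : ∀ c : A, (fun i => ((Fin.snoc u c : Fin (n + 2) → A) i,
        (Fin.snoc v d : Fin (n + 2) → B) i)) =
        (Fin.snoc (fun i => (u i, v i)) (c, d) : Fin (n + 2) → A × B) := by
      intro c
      funext i
      refine Fin.lastCases ?_ (fun j => ?_) i <;> simp
    simp only [hs, chainWeight_snoc]
    rw [← Finset.mul_sum, ← Finset.sum_div]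
    rcases eq_or_ne (W (u (Fin.last n), v (Fin.last n))) 0 with h0 | h0
    · rw [chainWeight_eq_zero_of_last h h0, zero_mul, zero_mul]
    have h1 : W' (v (Fin.last n)) ≠ 0 := by
      rw [← hW]
      intro hz
      rw [Finset.sum_eq_zero_iff_of_nonneg fun _ _ => h.weight_nonneg _] at hz
      exact h0 (hz _ (Finset.mem_univ _))
    congr 1
    rw [div_eq_div_iff h0 h1, hK, mul_comm]

/-- If `b` is summed out of the transition `(a, b) → (c, d)` and the result depends on `d` only
through `c`, then the first component of the chain is a Markov chain. -/
theorem sum_chainWeight_snd (h : IsStationaryPair_s3 K W) {K' : A → A → ℝ} {W' : A → ℝ}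
    (hK' : IsStationaryPair_s3 K' W') (hW : ∀ a, ∑ b, W (a, b) = W' a)
    (hK : ∀ a c d, (∑ b, K (a, b) (c, d)) * W' c = K' a c * W (c, d))
    (n : ℕ) (u : Fin (n + 1) → A) :
    ∑ v : Fin (n + 1) → B, chainWeight K W n (fun i => (u i, v i)) = chainWeight K' W' n u := by
  induction n with
  | zero =>
    simp only [chainWeight, Finset.univ_eq_empty, Finset.prod_empty, mul_one, ← hW]
    exact Fintype.sum_equiv (Equiv.funUnique (Fin 1) B) _ _ fun _ => rfl
  | succ n ih =>
    obtain ⟨a, u, rfl⟩ : ∃ (a : A) (u' : Fin (n + 1) → A), u = Fin.cons a u' :=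
      ⟨u 0, Fin.tail u, (Fin.cons_self_tail u).symm⟩
    rw [sum_fin_cons, chainWeight_cons hK', ← ih, Finset.mul_sum]
    refine Finset.sum_congr rfl fun v _ => ?_
    have hs : ∀ b : B, (fun i => ((Fin.cons a u : Fin (n + 2) → A) i,
        (Fin.cons b v : Fin (n + 2) → B) i)) =
        (Fin.cons (a, b) (fun i => (u i, v i)) : Fin (n + 2) → A × B) := by
      intro c
      funext i
      refine Fin.cases ?_ (fun j => ?_) i <;> simp
    simp only [hs, chainWeight_cons h]
    rw [← Finset.sum_mul, ← Finset.sum_div]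
    rcases eq_or_ne (W (u 0, v 0)) 0 with h0 | h0
    · rw [chainWeight_eq_zero_of_first (K := K) (x := fun i => (u i, v i)) h0, mul_zero, mul_zero]
    have h1 : W' (u 0) ≠ 0 := by
      rw [← hW]
      intro hz
      rw [Finset.sum_eq_zero_iff_of_nonneg fun _ _ => h.weight_nonneg _] at hz
      exact h0 (hz _ (Finset.mem_univ _))
    congr 1
    rw [div_eq_div_iff h0 h1, hK]

end Lumping

/-- Equality in strong subadditivity of entropy forces conditional independence. -/
theorem mul_eq_mul_of_entropy_eq_s3 {A B C : Type*} [Fintype A] [Fintype B] [Fintype C]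
    (F : A → B → C → ℝ) (hF : ∀ a b c, 0 ≤ F a b c)
    (G : A → B → ℝ) (H : B → C → ℝ) (w : B → ℝ)
    (hG : ∀ a b, ∑ c, F a b c = G a b) (hH : ∀ b c, ∑ a, F a b c = H b c)
    (hw : ∀ b, ∑ a, G a b = w b)
    (hent : ∑ a, ∑ b, ∑ c, F a b c * Real.log (F a b c) + ∑ b, w b * Real.log (w b) =
      ∑ a, ∑ b, G a b * Real.log (G a b) + ∑ b, ∑ c, H b c * Real.log (H b c))
    (a : A) (b : B) (c : C) :
    F a b c * w b = G a b * H b c := by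
  have hw' : ∀ b, ∑ c, H b c = w b := fun b => by
    simp only [← hw, ← hG, ← hH]
    exact Finset.sum_comm
  have hG0 : ∀ a b, 0 ≤ G a b := fun a b => hG a b ▸ Finset.sum_nonneg fun c _ => hF a b c
  have hH0 : ∀ b c, 0 ≤ H b c := fun b c => hH b c ▸ Finset.sum_nonneg fun a _ => hF a b c
  have hw0 : ∀ b, 0 ≤ w b := fun b => hw b ▸ Finset.sum_nonneg fun a _ => hG0 a b
  have hFG : ∀ a b c, F a b c ≤ G a b := fun a b c => by
    rw [← hG]
    exact Finset.single_le_sum (f := fun c => F a b c) (fun c _ => hF a b c) (Finset.mem_univ c)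
  have hFH : ∀ a b c, F a b c ≤ H b c := fun a b c => by
    rw [← hH]
    exact Finset.single_le_sum (f := fun a => F a b c) (fun a _ => hF a b c) (Finset.mem_univ a)
  have hGw : ∀ a b, G a b ≤ w b := fun a b => by
    rw [← hw]
    exact Finset.single_le_sum (f := fun a => G a b) (fun a _ => hG0 a b) (Finset.mem_univ a)
  set D : A → B → C → ℝ := fun a b c =>
    F a b c * (Real.log (F a b c) + Real.log (w b) - Real.log (G a b) - Real.log (H b c)) +
      (G a b * H b c / w b - F a b c) with hD
  have key : ∀ a b c, 0 ≤ D a b c ∧ (D a b c = 0 → F a b c * w b = G a b * H b c) := by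
    intro a b c
    rcases (hF a b c).eq_or_lt with h0 | hpos
    · have hq : 0 ≤ G a b * H b c / w b := div_nonneg (mul_nonneg (hG0 a b) (hH0 b c)) (hw0 b)
      refine ⟨by simpa [hD, ← h0] using hq, fun hz => ?_⟩
      have hz' : G a b * H b c / w b = 0 := by simpa [hD, ← h0] using hz
      rcases div_eq_zero_iff.1 hz' with h | h
      · rw [h, ← h0, zero_mul]
      · have : G a b = 0 := le_antisymm (h ▸ hGw a b) (hG0 a b)
        rw [h, this, mul_zero, zero_mul]
    · have g := hpos.trans_le (hFG a b c)
      have k := hpos.trans_le (hFH a b c)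
      have l := g.trans_le (hGw a b)
      set t := G a b * H b c / (w b * F a b c) with ht
      have htpos : 0 < t := by positivity
      have hlog : Real.log t =
          -(Real.log (F a b c) + Real.log (w b) - Real.log (G a b) - Real.log (H b c)) := by
        rw [ht, Real.log_div (by positivity) (by positivity), Real.log_mul g.ne' k.ne',
          Real.log_mul l.ne' hpos.ne']
        ring
      have hDt : D a b c = F a b c * (t - 1 - Real.log t) := by
        rw [hlog, ht]
        simp only [hD]
        field_simp
        ring
      refine ⟨?_, fun hz => ?_⟩
      · rw [hDt]
        exact mul_nonneg hpos.le (by linarith [Real.log_le_sub_one_of_pos htpos])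
      · rw [hDt] at hz
        have hz' := (mul_eq_zero.1 hz).resolve_left hpos.ne'
        have ht1 : t = 1 := by
          by_contra hne
          linarith [Real.log_lt_sub_one_of_pos htpos hne]
        rw [ht, div_eq_one_iff_eq (by positivity)] at ht1
        rw [ht1, mul_comm]
  have hsumw : ∑ a, ∑ b, ∑ c, F a b c * Real.log (w b) = ∑ b, w b * Real.log (w b) := by
    rw [Finset.sum_comm]
    simp only [← Finset.sum_mul, hG, hw]
  have hsumG : ∑ a, ∑ b, ∑ c, F a b c * Real.log (G a b) =
      ∑ a, ∑ b, G a b * Real.log (G a b) := by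
    simp only [← Finset.sum_mul, hG]
  have hsumH : ∑ a, ∑ b, ∑ c, F a b c * Real.log (H b c) =
      ∑ b, ∑ c, H b c * Real.log (H b c) := by
    rw [Finset.sum_comm]
    refine Finset.sum_congr rfl fun b _ => ?_
    rw [Finset.sum_comm]
    simp only [← Finset.sum_mul, hH]
  have hsumR : ∑ a, ∑ b, ∑ c, G a b * H b c / w b = ∑ a, ∑ b, ∑ c, F a b c := by
    refine Finset.sum_congr rfl fun a _ => Finset.sum_congr rfl fun b _ => ?_
    rw [← Finset.sum_div, ← Finset.mul_sum, hw', hG]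
    rcases eq_or_ne (w b) 0 with h | h
    · rw [h, div_zero]
      exact le_antisymm (hG0 a b) (h ▸ hGw a b)
    · exact mul_div_cancel_right₀ _ h
  have hsum : ∑ a, ∑ b, ∑ c, D a b c = 0 := by
    simp only [hD, mul_add, mul_sub, Finset.sum_add_distrib, Finset.sum_sub_distrib, hsumw, hsumG,
      hsumH, hsumR]
    linarith
  have h1 := (Finset.sum_eq_zero_iff_of_nonneg fun a _ => Finset.sum_nonneg fun b _ =>
    Finset.sum_nonneg fun c _ => (key a b c).1).1 hsum a (Finset.mem_univ a)
  have h2 := (Finset.sum_eq_zero_iff_of_nonneg fun b _ =>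
    Finset.sum_nonneg fun c _ => (key a b c).1).1 h1 b (Finset.mem_univ b)
  have h3 := (Finset.sum_eq_zero_iff_of_nonneg fun c _ => (key a b c).1).1 h2 c (Finset.mem_univ c)
  exact (key a b c).2 h3

section Cluster

variable {S : Type*} [Fintype S] {P : S × S × S × S → ℝ}

/-- `P` as a pair law on horizontal edges: the transition from `(a, b)` to `(c, d)`. -/
def edgePair (P : S × S × S × S → ℝ) : S × S → S × S → ℝ :=
  fun p q => P (p.1, p.2, q.1, q.2)

theorem sum_margAB_right (P : S × S × S × S → ℝ) (a : S) :
    ∑ b, margAB P (a, b) = margA P a := rfl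

theorem sum_margAB_left (hCL : CL P) (b : S) : ∑ a, margAB P (a, b) = margA P b := by
  have h : ∑ a, margAB P (a, b) = ∑ d, margBD P (b, d) := by
    simp only [margAB, margBD]
    conv_rhs => rw [Finset.sum_comm]
    exact Finset.sum_congr rfl fun x _ => Finset.sum_comm
  rw [h, ← hCL.2]
  simp only [margAC, margA]
  rw [Finset.sum_comm]

theorem sum_margAC_right (P : S × S × S × S → ℝ) (a : S) :
    ∑ c, margAC P (a, c) = margA P a := Finset.sum_comm

theorem sum_margAC_left (hCL : CL P) (c : S) : ∑ a, margAC P (a, c) = margA P c := by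
  have h : ∑ a, margAC P (a, c) = ∑ d, margCD P (c, d) := by
    simp only [margAC, margCD]
    conv_rhs => rw [Finset.sum_comm]
    exact Finset.sum_congr rfl fun x _ => Finset.sum_comm
  rw [h, ← hCL.1, sum_margAB_right]

theorem isStationaryPair_edgePair (hP : ∀ x, 0 ≤ P x) (hCL : CL P) :
    IsStationaryPair_s3 (edgePair P) (margAB P) where
  nonneg _ _ := hP _
  sum_right _ := Fintype.sum_prod_type _
  sum_left y := by
    rw [hCL.1]
    exact Fintype.sum_prod_type _

theorem isStationaryPair_margAC (hP : ∀ x, 0 ≤ P x) (hCL : CL P) :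
    IsStationaryPair_s3 (fun a c => margAC P (a, c)) (margA P) where
  nonneg _ _ := Finset.sum_nonneg fun _ _ => Finset.sum_nonneg fun _ _ => hP _
  sum_right := sum_margAC_right P
  sum_left := sum_margAC_left hCL

theorem margABD_mul_margA (hP : ∀ x, 0 ≤ P x) (hCL : CL P) (hCM : CM P) (a b d : S) :
    margABD P (a, b, d) * margA P b = margAB P (a, b) * margAC P (b, d) := by
  refine mul_eq_mul_of_entropy_eq_s3 (fun a b d => margABD P (a, b, d))
    (fun _ _ _ => Finset.sum_nonneg fun _ _ => hP _) (fun a b => margAB P (a, b))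
    (fun b d => margAC P (b, d)) (margA P) (fun _ _ => Finset.sum_comm)
    (fun b d => ?_) (sum_margAB_left hCL) ?_ a b d
  · rw [hCL.2]
    rfl
  · have h := hCM.1
    simp only [entropy, Fintype.sum_prod_type] at h
    linarith

theorem margACD_mul_margA (hP : ∀ x, 0 ≤ P x) (hCL : CL P) (hCM : CM P) (a c d : S) :
    margACD P (a, c, d) * margA P c = margAC P (a, c) * margAB P (c, d) := by
  refine mul_eq_mul_of_entropy_eq_s3 (fun a c d => margACD P (a, c, d))
    (fun _ _ _ => Finset.sum_nonneg fun _ _ => hP _) (fun a c => margAC P (a, c))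
    (fun c d => margAB P (c, d)) (margA P) (fun _ _ => Finset.sum_comm)
    (fun c d => ?_) (sum_margAC_left hCL) ?_ a c d
  · rw [hCL.1]
    rfl
  · have h := hCM.2
    simp only [entropy, Fintype.sum_prod_type] at h
    linarith

/-- The law of a column of height `m + 1`. -/
noncomputable def columnWeight (P : S × S × S × S → ℝ) (m : ℕ) : (Fin (m + 1) → S) → ℝ :=
  chainWeight (fun a c => margAC P (a, c)) (margA P) m

/-- The joint law of two adjacent columns of height `m + 1`. -/
noncomputable def columnPairWeight (P : S × S × S × S → ℝ) (m : ℕ)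
    (u v : Fin (m + 1) → S) : ℝ :=
  chainWeight (edgePair P) (margAB P) m fun j => (u j, v j)

theorem isStationaryPair_columnPairWeight (hP : ∀ x, 0 ≤ P x) (hCL : CL P) (hCM : CM P) (m : ℕ) :
    IsStationaryPair_s3 (columnPairWeight P m) (columnWeight P m) where
  nonneg _ _ := chainWeight_nonneg (isStationaryPair_edgePair hP hCL) m _
  sum_right := sum_chainWeight_snd (isStationaryPair_edgePair hP hCL)
    (isStationaryPair_margAC hP hCL) (sum_margAB_right P) (margACD_mul_margA hP hCL hCM) m
  sum_left := sum_chainWeight_fst (isStationaryPair_edgePair hP hCL)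
    (sum_margAB_left hCL) (margABD_mul_margA hP hCL hCM) m

theorem QNM_eq_chainWeight (hP : ∀ x, 0 ≤ P x) (hCL : CL P) (hCM : CM P) (n m : ℕ)
    (ω : Fin (n + 2) × Fin (m + 2) → S) :
    QNM P (n + 2) (m + 2) ω =
      chainWeight (columnPairWeight P (m + 1)) (columnWeight P (m + 1)) (n + 1)
        fun i j => ω (i, j) := by
  have hQ : QNM P (n + 2) (m + 2) ω = QNMnum P (n + 2) (m + 2) ω / QNMden P (n + 2) (m + 2) ω := by
    rw [QNM]
    split_ifs with h
    · rw [h, zero_div]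
    · rfl
  rw [hQ, chainWeight_eq_prod_div_prod (isStationaryPair_columnPairWeight hP hCL hCM _)]
  simp only [columnPairWeight, columnWeight,
    chainWeight_eq_prod_div_prod (isStationaryPair_edgePair hP hCL),
    chainWeight_eq_prod_div_prod (isStationaryPair_margAC hP hCL), Finset.prod_div_distrib]
  rw [div_div_div_eq, mul_comm (∏ i : Fin (n + 1), ∏ j : Fin m, _)]
  rfl

/-- The expectation of an observable of a single cluster under `QNM` is its `P`-expectation. -/
theorem sum_QNM_mul_cluster (hP : ∀ x, 0 ≤ P x) (hCL : CL P) (hCM : CM P) (n m : ℕ)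
    (i : Fin (n + 1)) (j : Fin (m + 1)) (f : S × S × S × S → ℝ) :
    ∑ ω : Fin (n + 2) × Fin (m + 2) → S,
      QNM P (n + 2) (m + 2) ω * f (cluster (N := n + 2) (M := m + 2) ω i j) = ∑ p, P p * f p := by
  calc
    _ = ∑ x : Fin (n + 2) → Fin (m + 2) → S,
        chainWeight (columnPairWeight P (m + 1)) (columnWeight P (m + 1)) (n + 1) x *
          f (x i.castSucc j.castSucc, x i.succ j.castSucc, x i.castSucc j.succ,
            x i.succ j.succ) := by
      refine Fintype.sum_equiv (Equiv.curry _ _ _) _ _ fun ω => ?_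
      rw [QNM_eq_chainWeight hP hCL hCM]
      rfl
    _ = ∑ u : Fin (m + 2) → S, ∑ v : Fin (m + 2) → S, columnPairWeight P (m + 1) u v *
          f (u j.castSucc, v j.castSucc, u j.succ, v j.succ) :=
      sum_chainWeight_mul_pair (isStationaryPair_columnPairWeight hP hCL hCM _) n i
        fun u v => f (u j.castSucc, v j.castSucc, u j.succ, v j.succ)
    _ = ∑ w : Fin (m + 2) → S × S, chainWeight (edgePair P) (margAB P) (m + 1) w *
          f ((w j.castSucc).1, (w j.castSucc).2, (w j.succ).1, (w j.succ).2) := by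
      rw [← Fintype.sum_prod_type']
      exact (Fintype.sum_equiv (Equiv.arrowProdEquivProdArrow _ _ _) _ _ fun _ => rfl).symm
    _ = ∑ p, ∑ q, edgePair P p q * f (p.1, p.2, q.1, q.2) :=
      sum_chainWeight_mul_pair (isStationaryPair_edgePair hP hCL) m j
        fun p q => f (p.1, p.2, q.1, q.2)
    _ = ∑ p, P p * f p := by
      simp only [Fintype.sum_prod_type, edgePair]

end Cluster

/-- for `N, M ≥ 3`, the explicitly constructed function `Q_{N,M}` is a
probability distribution and is consistent with `P`: every 2×2 cluster marginal of
`Q_{N,M}` equals `P`. -/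
theorem QNM_isProbDist_and_consistent
    {S : Type*} [Fintype S] [DecidableEq S] [Nonempty S]
    (P : S × S × S × S → ℝ) (hP : IsProbDist P) (hCL : CL P) (hCM : CM P)
    (N M : ℕ) (hN : 3 ≤ N) (hM : 3 ≤ M) :
    IsProbDist (QNM P N M) ∧ Consistent (QNM P N M) P := by
  obtain ⟨n, rfl⟩ : ∃ n, N = n + 2 := ⟨N - 2, by omega⟩
  obtain ⟨m, rfl⟩ : ∃ m, M = m + 2 := ⟨M - 2, by omega⟩
  refine ⟨⟨fun ω => ?_, ?_⟩, fun i j => ?_⟩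
  · rw [QNM_eq_chainWeight hP.1 hCL hCM]
    exact chainWeight_nonneg (isStationaryPair_columnPairWeight hP.1 hCL hCM _) _ _
  · have h := sum_QNM_mul_cluster hP.1 hCL hCM n m 0 0 fun _ => 1
    simpa only [mul_one, hP.2] using h
  · funext p
    have h := sum_QNM_mul_cluster hP.1 hCL hCM n m i j fun q => if q = p then 1 else 0
    simpa [marginalAt] using h
end
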